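/- arXiv:1203.6336 — 5 statements merged into one kernel-verified Lean document; each statement's English description precedes it below -/
import Mathlib

section
/- Let A^{ij} and B^{ij} be antisymmetric bivector components on ℝ⁴ and let ρ, f ∈ ℝ. If the medium tensor ρ(Ā⊗B) + ρ(B̄⊗A) + f·Id is zero (all components vanish), then f = 0, and moreover ρ = 0 or A = 0 or B = 0. -/
noncomputable section
open Matrix BigOperators

/-- Medium tensor components `κ^{ij}_{rs}` on ℝ⁴ (upper indices first). -/
abbrev MT := Fin 4 → Fin 4 → Fin 4 → Fin 4 → ℝ

/-- Bivector (or 2-form) components on ℝ⁴. -/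
abbrev BV := Fin 4 → Fin 4 → ℝ

/-- Totally antisymmetric Levi-Civita symbol on {0,1,2,3} with ε₀₁₂₃ = 1. -/
def eps (i j k l : Fin 4) : ℝ :=
  ((j.val : ℝ) - i.val) * ((k.val : ℝ) - i.val) * ((l.val : ℝ) - i.val) *
    ((k.val : ℝ) - j.val) * ((l.val : ℝ) - j.val) * ((l.val : ℝ) - k.val) / 12

/-- Identity medium tensor `Id^{ij}_{rs} = δ^i_r δ^j_s − δ^i_s δ^j_r`. -/
def idT : MT := fun i j r s =>
  (if i = r then (1 : ℝ) else 0) * (if j = s then 1 else 0) -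
    (if i = s then 1 else 0) * (if j = r then 1 else 0)

/-- Composition `(κ∘η)^{ij}_{rs} = (1/2) κ^{ab}_{rs} η^{ij}_{ab}`. -/
def compT (κ η : MT) : MT := fun i j r s => (1 / 2) * ∑ a, ∑ b, κ a b r s * η i j a b

/-- Poincaré adjoint `κ̄^{ij}_{rs} = (1/4) ε_{rsab} κ^{ab}_{cd} ε^{cdij}`. -/
def adjT (κ : MT) : MT := fun i j r s =>
  (1 / 4) * ∑ a, ∑ b, ∑ c, ∑ d, eps r s a b * κ a b c d * eps c d i j

/-- Trace `tr κ = (1/2) κ^{ij}_{ij}`. -/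
def traceT (κ : MT) : ℝ := (1 / 2) * ∑ i, ∑ j, κ i j i j

def antisymBV (A : BV) : Prop := ∀ i j, A i j = - A j i

def antisymMT (κ : MT) : Prop :=
  (∀ i j r s, κ i j r s = - κ j i r s) ∧ (∀ i j r s, κ i j r s = - κ i j s r)

/-- The medium tensor `(ρ Ā⊗B)^{ij}_{rs} = ρ ε_{rsab} A^{ab} B^{ij}`. -/
def tensAB (ρ : ℝ) (A B : BV) : MT := fun i j r s =>
  ρ * (∑ a, ∑ b, eps r s a b * A a b) * B i j

/-- Hodge star `(∗_g)^{ij}_{rs} = √|det g| g^{ia} g^{jb} ε_{abrs}`. -/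
def hodge (g : Matrix (Fin 4) (Fin 4) ℝ) : MT := fun i j r s =>
  Real.sqrt |g.det| * ∑ a, ∑ b, g⁻¹ i a * g⁻¹ j b * eps a b r s

/-- The (non-symmetrised) Fresnel tensor density `𝒢₀^{ijkl}`. -/
def G0 (κ : MT) (i j k l : Fin 4) : ℝ :=
  (1 / 48) * ∑ a₁, ∑ a₂, ∑ a₃, ∑ a₄, ∑ b₁, ∑ b₂, ∑ b₃, ∑ b₄, ∑ b₅, ∑ b₆,
    κ a₁ a₂ b₁ b₂ * κ a₃ i b₃ b₄ * κ a₄ j b₅ b₆ *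
      eps b₁ b₂ b₅ k * eps b₃ b₄ b₆ l * eps a₁ a₂ a₃ a₄

/-- Fresnel polynomial `G(ξ) = 𝒢₀^{ijkl} ξ_i ξ_j ξ_k ξ_l`. -/
def fresnel (κ : MT) (ξ : Fin 4 → ℝ) : ℝ :=
  ∑ i, ∑ j, ∑ k, ∑ l, G0 κ i j k l * ξ i * ξ j * ξ k * ξ l

/-- A Lorentz metric: real symmetric invertible 4×4 matrix of signature
(−+++) or (+−−−), equivalently symmetric with negative determinant. -/
def IsLorentz (g : Matrix (Fin 4) (Fin 4) ℝ) : Prop := g.IsSymm ∧ g.det < 0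

/-- Null cone `N(g) = {ξ : g^{ij} ξ_i ξ_j = 0}` (on covectors, via the inverse metric). -/
def nullCone (g : Matrix (Fin 4) (Fin 4) ℝ) : Set (Fin 4 → ℝ) :=
  {ξ | ∑ i, ∑ j, g⁻¹ i j * ξ i * ξ j = 0}

/-- The ordering O = (01, 02, 03, 23, 31, 12) of index pairs. -/
def pairs : Fin 6 → Fin 4 × Fin 4 := ![(0, 1), (0, 2), (0, 3), (2, 3), (3, 1), (1, 2)]

/-- The 6×6 matrix representing a medium tensor: `M_{IJ} = κ^{J₁J₂}_{I₁I₂}`. -/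
def mat6 (κ : MT) : Matrix (Fin 6) (Fin 6) ℝ := fun I J =>
  κ (pairs J).1 (pairs J).2 (pairs I).1 (pairs I).2

/-- The Fresnel surface decomposes into a double light cone. -/
def DoubleCone (κ : MT) : Prop :=
  ∃ gp gm, IsLorentz gp ∧ IsLorentz gm ∧ nullCone gp ≠ nullCone gm ∧
    {ξ | fresnel κ ξ = 0} = nullCone gp ∪ nullCone gm

/-- A sum of two rank-one `3 × 3` matrices is singular, so it is a multiple of the identity only
if it vanishes. -/
lemma eq_zero_of_rank_two_eq_scalar {u v w z : Fin 3 → ℝ} {c : ℝ}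
    (h : ∀ i j, u i * v j + w i * z j = if i = j then c else 0) : c = 0 := by
  have h_mat : Matrix.of (fun i j => u i * v j + w i * z j) = Matrix.diagonal fun _ => c := by
    ext i j
    simp [h, Matrix.diagonal_apply]
  have h_det := congrArg Matrix.det h_mat
  rw [Matrix.det_diagonal, Matrix.det_fin_three] at h_det
  simp only [Matrix.of_apply, Finset.prod_const, Finset.card_univ, Fintype.card_fin] at h_det
  have h_pow : c ^ 3 = 0 := by
    rw [← h_det]
    ring
  exact pow_eq_zero_iff (three_ne_zero) |>.mp h_pow

/-- Every component of a bivector is, up to a factor 2, a component of its dual 2-form. -/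
lemma exists_dual_eq_two_mul (k l : Fin 4) :
    ∃ r s, ∀ A : BV, antisymBV A → ∑ a, ∑ b, eps r s a b * A a b = 2 * A k l := by
  have key : ∃ r s, ∀ a b, eps r s a b =
      (if a = k ∧ b = l then 1 else 0) - (if a = l ∧ b = k then 1 else 0) := by
    fin_cases k <;> fin_cases l
    on_goal 2 => refine ⟨2, 3, fun a b => ?_⟩
    on_goal 3 => refine ⟨3, 1, fun a b => ?_⟩
    on_goal 4 => refine ⟨1, 2, fun a b => ?_⟩
    on_goal 5 => refine ⟨3, 2, fun a b => ?_⟩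
    on_goal 7 => refine ⟨0, 3, fun a b => ?_⟩
    on_goal 8 => refine ⟨2, 0, fun a b => ?_⟩
    on_goal 9 => refine ⟨1, 3, fun a b => ?_⟩
    on_goal 10 => refine ⟨3, 0, fun a b => ?_⟩
    on_goal 12 => refine ⟨0, 1, fun a b => ?_⟩
    on_goal 13 => refine ⟨2, 1, fun a b => ?_⟩
    on_goal 14 => refine ⟨0, 2, fun a b => ?_⟩
    on_goal 15 => refine ⟨1, 0, fun a b => ?_⟩
    all_goals try exact ⟨0, 0, fun a b => by simp [eps]⟩
    all_goals fin_cases a <;> fin_cases b <;> norm_num [eps, Fin.ext_iff]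
  obtain ⟨r, s, hrs⟩ := key
  refine ⟨r, s, fun A hA => ?_⟩
  simp only [hrs, sub_mul, Finset.sum_sub_distrib, ite_and, ite_mul, one_mul, zero_mul,
    Finset.sum_ite_irrel, Finset.sum_ite_eq', Finset.mem_univ, if_true, Finset.sum_const_zero]
  linarith [hA k l]

/-- If ρ(Ā⊗B) + ρ(B̄⊗A) + f·Id = 0 then f = 0, and ρ = 0 or A = 0 or B = 0. -/
theorem stmt4 (ρ f : ℝ) (A B : BV) (hA : antisymBV A) (hB : antisymBV B)
    (h : ∀ i j r s, tensAB ρ A B i j r s + tensAB ρ B A i j r s + f * idT i j r s = 0) :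
    f = 0 ∧ (ρ = 0 ∨ A = 0 ∨ B = 0) := by
  have hf : f = 0 := by
    refine neg_eq_zero.mp <| eq_zero_of_rank_two_eq_scalar
      (u := fun i => ρ * ∑ a, ∑ b, eps 0 i.succ a b * A a b) (v := fun j => B 0 j.succ)
      (w := fun i => ρ * ∑ a, ∑ b, eps 0 i.succ a b * B a b) (z := fun j => A 0 j.succ)
      fun i j => ?_
    have hij := h 0 j.succ 0 i.succ
    simp only [tensAB, idT, Fin.succ_inj, (Fin.succ_ne_zero _).symm, Fin.succ_ne_zero,
      if_true, if_false, one_mul, zero_mul, sub_zero, eq_comm (a := j)] at hij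
    split_ifs at hij ⊢ <;> linarith
  subst hf
  refine ⟨rfl, or_iff_not_imp_left.mpr fun hρ => ?_⟩
  have h_sym (i j k l : Fin 4) : A k l * B i j + B k l * A i j = 0 := by
    obtain ⟨r, s, hrs⟩ := exists_dual_eq_two_mul k l
    have hij := h i j r s
    rw [tensAB, tensAB, hrs A hA, hrs B hB] at hij
    refine (mul_eq_zero.mp (?_ : ρ * _ = 0)).resolve_left hρ
    linarith
  refine or_iff_not_imp_left.mpr fun hA_ne => ?_
  obtain ⟨k, hk⟩ := Function.ne_iff.mp hA_ne
  obtain ⟨l, hkl⟩ := Function.ne_iff.mp hk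
  have hB_kl : B k l = 0 := by
    refine (mul_eq_zero.mp (?_ : A k l * B k l = 0)).resolve_left hkl
    linarith [h_sym k l k l]
  ext i j
  simpa [hB_kl, show A k l ≠ 0 from hkl] using h_sym i j k l
end
end

section
/- (Pointwise Schönberg representation.) Suppose κ is a skewon-free medium tensor on ℝ⁴ satisfying the closure condition κ∘κ = −λ·Id for some real λ > 0. Then there exist a Lorentz metric g (a real symmetric invertible 4×4 matrix with det g < 0) and a real number f ≠ 0 such that κ = f·∗_g. -/
noncomputable section
open Matrix BigOperators

/-- The off-diagonal pairing of two three-element index sets: the Levi-Civita symbol on ordered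
index pairs. -/
def epsPairing : Matrix (Fin 3 ⊕ Fin 3) (Fin 3 ⊕ Fin 3) ℝ := fromBlocks 0 1 1 0

/-- The ordering `O` of index pairs, split into the pairs `0i` and their duals. -/
def splitPairs : Fin 3 ⊕ Fin 3 → Fin 4 × Fin 4 :=
  Sum.elim ![(0, 1), (0, 2), (0, 3)] ![(2, 3), (3, 1), (1, 2)]

/-- The second compound matrix of a `4 × 4` matrix. -/
def compound (P : Matrix (Fin 4) (Fin 4) ℝ) : Matrix (Fin 3 ⊕ Fin 3) (Fin 3 ⊕ Fin 3) ℝ :=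
  fun I J => P (splitPairs I).1 (splitPairs J).1 * P (splitPairs I).2 (splitPairs J).2 -
    P (splitPairs I).1 (splitPairs J).2 * P (splitPairs I).2 (splitPairs J).1

lemma compound_mul (P Q : Matrix (Fin 4) (Fin 4) ℝ) :
    compound (P * Q) = compound P * compound Q := by
  ext I J
  simp only [compound, Matrix.mul_apply, Fintype.sum_sum_type, Fin.sum_univ_three,
    Fin.sum_univ_four]
  simp [splitPairs]
  ring

lemma compound_transpose (P : Matrix (Fin 4) (Fin 4) ℝ) :
    compound Pᵀ = (compound P)ᵀ := by
  ext I J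
  simp only [compound, transpose_apply]
  ring

lemma compound_one : compound 1 = 1 := by
  ext (i | i) (j | j) <;> fin_cases i <;> fin_cases j <;>
    simp [compound, splitPairs, Matrix.one_apply]

set_option maxHeartbeats 1600000 in
lemma compound_mul_epsPairing_mul_transpose (P : Matrix (Fin 4) (Fin 4) ℝ) :
    compound P * epsPairing * (compound P)ᵀ = P.det • epsPairing := by
  have hdet := Matrix.det_succ_row_zero P
  simp [Fin.sum_univ_succ, Matrix.det_fin_three, Fin.succAbove] at hdet
  rw [hdet]
  simp only [epsPairing]
  clear hdet
  ext (i | i) (j | j) <;> fin_cases i <;> fin_cases j <;>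
    simp [compound, splitPairs, Matrix.mul_apply, Matrix.one_apply, Fin.sum_univ_three] <;> ring

/-- A `3 × 3` matrix acting on the last three coordinates. -/
def spatial (N : Matrix (Fin 3) (Fin 3) ℝ) : Matrix (Fin 4) (Fin 4) ℝ :=
  !![1, 0, 0, 0; 0, N 0 0, N 0 1, N 0 2; 0, N 1 0, N 1 1, N 1 2; 0, N 2 0, N 2 1, N 2 2]

lemma det_spatial (N : Matrix (Fin 3) (Fin 3) ℝ) : (spatial N).det = N.det := by
  rw [Matrix.det_succ_row_zero]
  simp [spatial, Fin.sum_univ_succ, Matrix.det_fin_three, Fin.succAbove]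

lemma compound_spatial (N : Matrix (Fin 3) (Fin 3) ℝ) :
    compound (spatial N) = fromBlocks N 0 0 N.adjugateᵀ := by
  ext (i | i) (j | j) <;> fin_cases i <;> fin_cases j <;>
    simp [compound, splitPairs, spatial, Matrix.adjugate_fin_three] <;> ring

/-- `X` is a nonzero multiple of the compound of a Lorentzian matrix. -/
def IsLorentzCompound (X : Matrix (Fin 3 ⊕ Fin 3) (Fin 3 ⊕ Fin 3) ℝ) : Prop :=
  ∃ (h : Matrix (Fin 4) (Fin 4) ℝ) (s : ℝ), h.IsSymm ∧ h.det < 0 ∧ s ≠ 0 ∧ X = s • compound h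

lemma IsLorentzCompound.of_congr {X : Matrix (Fin 3 ⊕ Fin 3) (Fin 3 ⊕ Fin 3) ℝ}
    {P : Matrix (Fin 4) (Fin 4) ℝ} (hP : P.det ≠ 0)
    (hX : IsLorentzCompound (compound P * X * (compound P)ᵀ)) : IsLorentzCompound X := by
  obtain ⟨h, s, hsymm, hdet, hs, heq⟩ := hX
  have hu : IsUnit P.det := isUnit_iff_ne_zero.mpr hP
  have hinv : compound P⁻¹ * compound P = 1 := by
    rw [← compound_mul, Matrix.nonsing_inv_mul _ hu, compound_one]
  have hinvT : (compound P)ᵀ * compound P⁻¹ᵀ = 1 := by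
    rw [compound_transpose, ← Matrix.transpose_mul, hinv, Matrix.transpose_one]
  refine ⟨P⁻¹ * h * P⁻¹ᵀ, s, ?_, ?_, hs, ?_⟩
  · simp only [Matrix.IsSymm, Matrix.transpose_mul, Matrix.transpose_transpose, hsymm.eq,
      Matrix.mul_assoc]
  · have hpos : 0 < P⁻¹.det * P⁻¹.det := by
      rw [Matrix.det_nonsing_inv, Ring.inverse_eq_inv']
      exact mul_self_pos.mpr (inv_ne_zero hP)
    rw [Matrix.det_mul, Matrix.det_mul, Matrix.det_transpose]
    nlinarith
  · calc X = (compound P⁻¹ * compound P) * X * ((compound P)ᵀ * compound P⁻¹ᵀ) := by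
          rw [hinv, hinvT, Matrix.one_mul, Matrix.mul_one]
      _ = compound P⁻¹ * (compound P * X * (compound P)ᵀ) * compound P⁻¹ᵀ := by
          simp only [Matrix.mul_assoc]
      _ = s • compound (P⁻¹ * h * P⁻¹ᵀ) := by
          rw [heq, compound_mul, compound_mul, Matrix.mul_smul, Matrix.smul_mul]

lemma fromBlocks_closure_iff (R S Q : Matrix (Fin 3) (Fin 3) ℝ) (lam : ℝ) :
    fromBlocks R S Sᵀ Q * epsPairing * fromBlocks R S Sᵀ Q = -lam • epsPairing ↔
      S * R + R * Sᵀ = 0 ∧ S * S + R * Q = -lam • 1 ∧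
        Q * R + Sᵀ * Sᵀ = -lam • 1 ∧ Q * S + Sᵀ * Q = 0 := by
  simp [epsPairing, fromBlocks_multiply, fromBlocks_smul, fromBlocks_neg, fromBlocks_inj]

lemma isLorentzCompound_of_det_ne_zero {R S Q : Matrix (Fin 3) (Fin 3) ℝ} {lam : ℝ}
    (hlam : 0 < lam) (hR : R.IsSymm) (hdet : R.det ≠ 0)
    (hSR : S * R + R * Sᵀ = 0) (hSS : S * S + R * Q = -lam • 1) :
    IsLorentzCompound (fromBlocks R S Sᵀ Q) := by
  have hu : IsUnit R.det := isUnit_iff_ne_zero.mpr hdet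
  obtain ⟨T, hT⟩ : ∃ T, T = R⁻¹ * S := ⟨_, rfl⟩
  have hS : S = R * T := by rw [hT, Matrix.mul_nonsing_inv_cancel_left _ _ hu]
  have hTT : Tᵀ = -T := by
    have : R * (T + Tᵀ) * R = 0 := by
      rw [hS, Matrix.transpose_mul, hR.eq] at hSR
      rw [Matrix.mul_add, Matrix.add_mul, Matrix.mul_assoc R Tᵀ R, hSR]
    have h2 : R⁻¹ * (R * (T + Tᵀ) * R) * R⁻¹ = T + Tᵀ := by
      rw [Matrix.mul_assoc R, Matrix.nonsing_inv_mul_cancel_left _ _ hu,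
        Matrix.mul_nonsing_inv_cancel_right _ _ hu]
    rw [this] at h2
    simp only [Matrix.mul_zero, Matrix.zero_mul] at h2
    exact (neg_eq_of_add_eq_zero_right h2.symm).symm
  have hQ : Q = -(lam / R.det) • R.adjugate - T * R * T := by
    have h1 : R * Q = -lam • 1 - R * T * (R * T) := by
      rw [← hSS, hS]; abel
    have h2 : Q = R⁻¹ * (R * Q) := (Matrix.nonsing_inv_mul_cancel_left _ _ hu).symm
    rw [h2, h1, Matrix.mul_sub, Matrix.mul_assoc R T, Matrix.nonsing_inv_mul_cancel_left _ _ hu,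
      Matrix.inv_def, Ring.inverse_eq_inv']
    simp [smul_smul, div_eq_mul_inv, Matrix.mul_assoc]
  have hr := fun i j => congrFun (congrFun hR.eq i) j
  have ht := fun i j => congrFun (congrFun hTT i) j
  simp only [transpose_apply, Matrix.neg_apply] at hr ht
  have t0 : T 0 0 = 0 := by linarith [ht 0 0]
  have t1 : T 1 1 = 0 := by linarith [ht 1 1]
  have t2 : T 2 2 = 0 := by linarith [ht 2 2]
  obtain ⟨d, hd⟩ : ∃ d, d = R.det := ⟨_, rfl⟩
  have hd' := hd
  rw [Matrix.det_fin_three, hr 0 1, hr 0 2, hr 1 2] at hd'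
  rw [← hd] at hdet hQ
  obtain ⟨s, hs⟩ : ∃ s, s = -d / lam := ⟨_, rfl⟩
  have hs0 : s ≠ 0 := by rw [hs]; exact div_ne_zero (neg_ne_zero.mpr hdet) hlam.ne'
  have hds : d = -lam * s := by rw [hs]; field_simp
  let h : Matrix (Fin 4) (Fin 4) ℝ :=
    !![1, T 1 2, T 2 0, T 0 1;
      T 1 2, R 0 0 / s + T 1 2 * T 1 2, R 0 1 / s + T 1 2 * T 2 0, R 0 2 / s + T 1 2 * T 0 1;
      T 2 0, R 0 1 / s + T 1 2 * T 2 0, R 1 1 / s + T 2 0 * T 2 0, R 1 2 / s + T 2 0 * T 0 1;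
      T 0 1, R 0 2 / s + T 1 2 * T 0 1, R 1 2 / s + T 2 0 * T 0 1, R 2 2 / s + T 0 1 * T 0 1]
  have hh : h.det = d / s ^ 3 := by
    rw [hd', Matrix.det_succ_row_zero]
    simp [h, Fin.sum_univ_succ, Matrix.det_fin_three, Fin.succAbove]
    field_simp
    ring
  refine ⟨h, s, ?_, ?_, hs0, ?_⟩
  · ext i j
    fin_cases i <;> fin_cases j <;> simp [h]
  · rw [hh, hds, show -lam * s / s ^ 3 = -(lam / s ^ 2) by field_simp]
    exact neg_neg_of_pos (by positivity)
  · have hlamd : lam / d = -s⁻¹ := by rw [hds]; field_simp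
    rw [hlamd] at hQ
    rw [hQ, hS]
    ext (i | i) (j | j) <;> fin_cases i <;> fin_cases j <;>
      simp [h, compound, splitPairs, Matrix.mul_apply, Fin.sum_univ_three,
        Matrix.adjugate_fin_three, t0, t1, t2, hr 0 1, hr 0 2, hr 1 2, ht 0 1, ht 0 2, ht 1 2] <;>
      field_simp <;> ring

lemma isLorentzCompound_of_normal_form {R S Q : Matrix (Fin 3) (Fin 3) ℝ} {lam : ℝ}
    (hlam : 0 < lam) (hR : R.IsSymm) (hQ : Q.IsSymm)
    (hR0 : ∀ j, R 0 j = 0) (hR1 : ∀ j, R 1 j = 0)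
    (h00 : S 0 0 = 0) (h02 : S 0 2 = 0) (h11 : S 1 1 = 0) (h12 : S 1 2 = 0)
    (hSR : S * R + R * Sᵀ = 0) (hSS : S * S + R * Q = -lam • 1) (hQS : Q * S + Sᵀ * Q = 0) :
    IsLorentzCompound (fromBlocks R S Sᵀ Q) := by
  have hr := fun i j => congrFun (congrFun hR.eq i) j
  have hq := fun i j => congrFun (congrFun hQ.eq i) j
  have sr := fun i j => congrFun (congrFun hSR i) j
  have ss := fun i j => congrFun (congrFun hSS i) j
  have qs := fun i j => congrFun (congrFun hQS i) j
  simp only [transpose_apply] at hr hq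
  have hr20 : R 2 0 = 0 := by rw [hr 0 2, hR0]
  have hr21 : R 2 1 = 0 := by rw [hr 1 2, hR1]
  simp only [Matrix.add_apply, Matrix.mul_apply, Fin.sum_univ_three, transpose_apply,
    Matrix.zero_apply, Matrix.smul_apply, smul_eq_mul] at sr ss qs
  have e00 := ss 0 0
  have e20 := ss 2 0
  have e21 := ss 2 1
  have e22 := ss 2 2
  have f22 := sr 2 2
  have g00 := qs 0 0
  have g01 := qs 0 1
  simp [hR0, hR1, hr20, hr21, h00, h02, h11, h12] at e00 e20 e21 e22 f22 g00 g01
  have hr0 : R 2 2 ≠ 0 := by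
    intro h
    rw [h] at e22
    nlinarith [mul_self_nonneg (S 2 2)]
  have h22 : S 2 2 = 0 := by
    have : S 2 2 * R 2 2 = 0 := by linarith
    exact (mul_eq_zero.mp this).resolve_right hr0
  rw [h22] at e20 e21 e22
  have hb : S 1 0 ≠ 0 := by
    intro h
    rw [h] at e00
    linarith
  have q20 : Q 2 0 = -(S 2 1 * S 1 0) / R 2 2 := by
    rw [eq_div_iff hr0]; linarith
  have q21 : Q 2 1 = -(S 2 0 * S 0 1) / R 2 2 := by
    rw [eq_div_iff hr0]; linarith
  have q22 : Q 2 2 = S 0 1 * S 1 0 / R 2 2 := by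
    rw [eq_div_iff hr0]; linarith
  have q01 : Q 0 1 = S 2 0 * S 2 1 / R 2 2 := by
    rw [hq 2 0, q20, hq 0 1] at g00
    field_simp at g00 ⊢
    exact mul_left_cancel₀ hb (by linarith)
  have q11 : Q 1 1 =
      -(Q 0 0 * S 0 1 - (S 2 1 ^ 2 * S 1 0 + S 2 0 ^ 2 * S 0 1) / R 2 2) / S 1 0 := by
    rw [hq 2 0, q20, q21] at g01
    field_simp at g01 ⊢
    linarith
  let h : Matrix (Fin 4) (Fin 4) ℝ :=
    !![0, 0, 0, 1;
      0, -S 0 1 / R 2 2, 0, -S 2 1 / R 2 2;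
      0, 0, S 1 0 / R 2 2, S 2 0 / R 2 2;
      1, -S 2 1 / R 2 2, S 2 0 / R 2 2,
        (-Q 0 0 / R 2 2 + (S 2 0 / R 2 2) ^ 2) * R 2 2 / S 1 0]
  have hh : h.det = S 0 1 * S 1 0 / R 2 2 ^ 2 := by
    rw [Matrix.det_succ_row_zero]
    simp [h, Fin.sum_univ_succ, Matrix.det_fin_three, Fin.succAbove]
    field_simp
  refine ⟨h, -R 2 2, ?_, ?_, neg_ne_zero.mpr hr0, ?_⟩
  · ext i j
    fin_cases i <;> fin_cases j <;> simp [h]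
  · rw [hh, e00, neg_div]
    exact neg_neg_of_pos (by positivity)
  · ext (i | i) (j | j) <;> fin_cases i <;> fin_cases j <;>
      simp [h, compound, splitPairs, hR0, hR1, hr20, hr21, h00, h02, h11, h12, h22, hq 0 1,
        hq 2 0, hq 2 1, q01, q11, q20, q21, q22] <;>
      field_simp <;> ring

lemma exists_matrix_of_det_eq_zero {R S Q : Matrix (Fin 3) (Fin 3) ℝ} {lam : ℝ}
    (hlam : 0 < lam) (hdet : R.det = 0)
    (hSR : S * R + R * Sᵀ = 0) (hSS : S * S + R * Q = -lam • 1) :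
    ∃ N : Matrix (Fin 3) (Fin 3) ℝ, N.det ≠ 0 ∧ N 0 ᵥ* R = 0 ∧ N 1 ᵥ* R = 0 ∧
      N 0 ᵥ* S = N 1 ∧ N 1 ᵥ* S = -lam • N 0 := by
  obtain ⟨w, hw, hwR⟩ := Matrix.exists_vecMul_eq_zero_iff.mpr hdet
  obtain ⟨u, hu⟩ : ∃ u, u = w ᵥ* S := ⟨_, rfl⟩
  have huR : u ᵥ* R = 0 := by
    rw [hu, Matrix.vecMul_vecMul, eq_neg_of_add_eq_zero_left hSR, Matrix.vecMul_neg,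
      ← Matrix.vecMul_vecMul, hwR, Matrix.zero_vecMul, neg_zero]
  have huS : u ᵥ* S = -lam • w := by
    rw [hu, Matrix.vecMul_vecMul, eq_sub_of_add_eq hSS, Matrix.vecMul_sub,
      ← Matrix.vecMul_vecMul, hwR, Matrix.zero_vecMul, sub_zero, Matrix.vecMul_smul,
      Matrix.vecMul_one]
  refine ⟨![w, u, w ⨯₃ u], ?_, hwR, huR, hu.symm, huS⟩
  have hww : 0 < w ⬝ᵥ w := by
    have h0 : w ⬝ᵥ w ≠ 0 := fun h => hw (dotProduct_self_eq_zero.mp h)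
    exact lt_of_le_of_ne (by simpa using dotProduct_star_self_nonneg w) h0.symm
  have hlin : w ⨯₃ u = 0 → False := by
    intro hz
    have hpar : (w ⬝ᵥ w) • u = (w ⬝ᵥ u) • w := by
      have h0 := congrFun hz 0
      have h1 := congrFun hz 1
      have h2 := congrFun hz 2
      simp [cross_apply] at h0 h1 h2
      ext i
      fin_cases i <;> simp [dotProduct, Fin.sum_univ_three]
      · linear_combination -w 1 * h2 + w 2 * h1
      · linear_combination w 0 * h2 - w 2 * h0
      · linear_combination -w 0 * h1 + w 1 * h0
    have hS := congrArg (fun v => (w ⬝ᵥ w) • (v ᵥ* S)) hpar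
    simp only [Matrix.smul_vecMul, huS, ← hu] at hS
    rw [smul_comm (w ⬝ᵥ w) (w ⬝ᵥ u), hpar] at hS
    have hd := congrArg (fun v => w ⬝ᵥ v) hS
    simp only [dotProduct_smul, smul_eq_mul] at hd
    have : 0 < (w ⬝ᵥ w) * ((w ⬝ᵥ w) * (lam * (w ⬝ᵥ w))) := by positivity
    nlinarith [mul_nonneg (mul_self_nonneg (w ⬝ᵥ u)) hww.le]
  have hdet' : Matrix.det ![w, u, w ⨯₃ u] = (w ⨯₃ u) ⬝ᵥ (w ⨯₃ u) := by
    rw [← triple_product_eq_det, triple_product_permutation, triple_product_permutation]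
  rw [hdet']
  exact fun h => hlin (dotProduct_self_eq_zero.mp h)

lemma isLorentzCompound_of_det_eq_zero {R S Q : Matrix (Fin 3) (Fin 3) ℝ} {lam : ℝ}
    (hlam : 0 < lam) (hR : R.IsSymm) (hQ : Q.IsSymm) (hdet : R.det = 0)
    (hX : fromBlocks R S Sᵀ Q * epsPairing * fromBlocks R S Sᵀ Q = -lam • epsPairing) :
    IsLorentzCompound (fromBlocks R S Sᵀ Q) := by
  obtain ⟨hSR, hSS, -, -⟩ := (fromBlocks_closure_iff R S Q lam).mp hX
  obtain ⟨N, hN, hR0, hR1, hS0, hS1⟩ := exists_matrix_of_det_eq_zero hlam hdet hSR hSS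
  have hP : (spatial N).det ≠ 0 := by rwa [det_spatial]
  refine IsLorentzCompound.of_congr hP ?_
  have hblocks : compound (spatial N) * fromBlocks R S Sᵀ Q * (compound (spatial N))ᵀ =
      fromBlocks (N * R * Nᵀ) (N * S * N.adjugate) (N * S * N.adjugate)ᵀ
        (N.adjugateᵀ * Q * N.adjugate) := by
    simp [compound_spatial, fromBlocks_transpose, fromBlocks_multiply, Matrix.mul_assoc]
  have hpair : (compound (spatial N))ᵀ * epsPairing * compound (spatial N) =
      N.det • epsPairing := by
    have := compound_mul_epsPairing_mul_transpose (spatial N)ᵀ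
    rwa [compound_transpose, Matrix.transpose_transpose, Matrix.det_transpose,
      det_spatial] at this
  have hpair' := compound_mul_epsPairing_mul_transpose (spatial N)
  rw [det_spatial] at hpair'
  have hX' : (compound (spatial N) * fromBlocks R S Sᵀ Q * (compound (spatial N))ᵀ) *
      epsPairing * (compound (spatial N) * fromBlocks R S Sᵀ Q * (compound (spatial N))ᵀ) =
      -(lam * N.det ^ 2) • epsPairing := by
    generalize compound (spatial N) = L at hpair hpair'
    generalize fromBlocks R S Sᵀ Q = X at hX
    calc L * X * Lᵀ * epsPairing * (L * X * Lᵀ)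
        = L * X * (Lᵀ * epsPairing * L) * X * Lᵀ := by simp only [Matrix.mul_assoc]
      _ = N.det • (L * (X * epsPairing * X) * Lᵀ) := by
          rw [hpair]; simp [Matrix.mul_assoc]
      _ = _ := by
          rw [hX, Matrix.mul_smul, Matrix.smul_mul, hpair', smul_smul, smul_smul]
          congr 1; ring
  rw [hblocks] at hX' ⊢
  obtain ⟨hSR', hSS', -, hQS'⟩ := (fromBlocks_closure_iff _ _ _ _).mp hX'
  have hadj := fun i j => congrFun (congrFun (Matrix.mul_adjugate N) i) j
  have hrow : ∀ (A B : Matrix (Fin 3) (Fin 3) ℝ) (i : Fin 3), (A * B) i = A i ᵥ* B :=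
    fun A B i => rfl
  have hS0' : (N * S * N.adjugate) 0 = (N * N.adjugate) 1 := by
    rw [hrow, hrow, hS0, hrow]
  have hS1' : (N * S * N.adjugate) 1 = -lam • (N * N.adjugate) 0 := by
    rw [hrow, hrow, hS1, hrow, Matrix.smul_vecMul]
  refine isLorentzCompound_of_normal_form (by positivity : 0 < lam * N.det ^ 2) ?_ ?_ ?_ ?_
    ?_ ?_ ?_ ?_ hSR' hSS' hQS'
  · simp [Matrix.IsSymm, Matrix.transpose_mul, hR.eq, Matrix.mul_assoc]
  · simp [Matrix.IsSymm, Matrix.transpose_mul, hQ.eq, Matrix.mul_assoc]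
  · intro j; rw [hrow, hrow, hR0, Matrix.zero_vecMul]; rfl
  · intro j; rw [hrow, hrow, hR1, Matrix.zero_vecMul]; rfl
  all_goals simp [hS0', hS1', hadj]

theorem isLorentzCompound_of_closure {X : Matrix (Fin 3 ⊕ Fin 3) (Fin 3 ⊕ Fin 3) ℝ} {lam : ℝ}
    (hlam : 0 < lam) (hsymm : X.IsSymm) (hX : X * epsPairing * X = -lam • epsPairing) :
    IsLorentzCompound X := by
  obtain ⟨R, S, S', Q, rfl⟩ : ∃ R S S' Q, X = fromBlocks R S S' Q :=
    ⟨_, _, _, _, (fromBlocks_toBlocks X).symm⟩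
  obtain ⟨hR, rfl, -, hQ⟩ := Matrix.isSymm_fromBlocks_iff.mp hsymm
  by_cases hdet : R.det = 0
  · exact isLorentzCompound_of_det_eq_zero hlam hR hQ hdet hX
  · obtain ⟨hSR, hSS, -, -⟩ := (fromBlocks_closure_iff R S Q lam).mp hX
    exact isLorentzCompound_of_det_ne_zero hlam hR hdet hSR hSS

/-- The matrix of a medium tensor with its lower index pair raised by the Levi-Civita symbol. -/
def raisedMatrix (κ : MT) : Matrix (Fin 3 ⊕ Fin 3) (Fin 3 ⊕ Fin 3) ℝ :=
  epsPairing * Matrix.of fun I J =>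
    κ (splitPairs J).1 (splitPairs J).2 (splitPairs I).1 (splitPairs I).2

lemma raisedMatrix_apply (κ : MT) (I J : Fin 3 ⊕ Fin 3) :
    raisedMatrix κ I J =
      κ (splitPairs J).1 (splitPairs J).2 (splitPairs I.swap).1 (splitPairs I.swap).2 := by
  rcases I with i | i <;>
    simp [raisedMatrix, epsPairing, Matrix.mul_apply, Matrix.one_apply]

lemma splitPairs_cases (i j : Fin 4) :
    i = j ∨ ∃ I, splitPairs I = (i, j) ∨ splitPairs I = (j, i) := by
  revert i j
  decide

lemma antisymMT.ext_raisedMatrix {κ η : MT} (hκ : antisymMT κ) (hη : antisymMT η)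
    (h : raisedMatrix κ = raisedMatrix η) : κ = η := by
  funext i j r s
  rcases splitPairs_cases i j with rfl | ⟨J, hJ⟩
  · linarith [hκ.1 i i r s, hη.1 i i r s]
  rcases splitPairs_cases r s with rfl | ⟨I, hI⟩
  · linarith [hκ.2 i j r r, hη.2 i j r r]
  have hIJ := congrFun (congrFun h I.swap) J
  rw [raisedMatrix_apply, raisedMatrix_apply, Sum.swap_swap] at hIJ
  rcases hI with hI | hI <;> rcases hJ with hJ | hJ <;> rw [hI, hJ] at hIJ <;>
    linarith [hκ.1 i j r s, hκ.2 i j r s, hη.1 i j r s, hη.2 i j r s, hκ.2 j i r s,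
      hη.2 j i r s]

lemma eps_pair_comm (i j k l : Fin 4) : eps i j k l = eps k l i j := by
  simp only [eps]
  ring

lemma eps_swap_right (i j k l : Fin 4) : eps i j k l = -eps i j l k := by
  simp only [eps]
  ring

lemma eps_swap_left (i j k l : Fin 4) : eps i j k l = -eps j i k l := by
  simp only [eps]
  ring

lemma sum_mul_eps_splitPairs (F : BV) (I : Fin 3 ⊕ Fin 3) :
    ∑ a, ∑ b, F a b * eps a b (splitPairs I).1 (splitPairs I).2 =
      F (splitPairs I.swap).1 (splitPairs I.swap).2 -
        F (splitPairs I.swap).2 (splitPairs I.swap).1 := by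
  rcases I with i | i <;> fin_cases i <;>
    simp [splitPairs, eps, Fin.sum_univ_four] <;> ring

lemma sum_eq_two_mul_sum_splitPairs (G : BV) (hsymm : ∀ a b, G a b = G b a)
    (hdiag : ∀ a, G a a = 0) :
    ∑ a, ∑ b, G a b = 2 * ∑ K, G (splitPairs K).1 (splitPairs K).2 := by
  simp [splitPairs, Fin.sum_univ_four, Fin.sum_univ_three, hdiag]
  linarith [hsymm 0 1, hsymm 0 2, hsymm 0 3, hsymm 1 2, hsymm 1 3, hsymm 2 3]

lemma raisedMatrix_isSymm {κ : MT} (hanti : antisymMT κ) (hskew : adjT κ = κ) :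
    (raisedMatrix κ).IsSymm := by
  ext I J
  rw [transpose_apply, raisedMatrix_apply, raisedMatrix_apply]
  conv_lhs => rw [← hskew]
  have hinner : ∀ a b, ∑ c, ∑ d, eps (splitPairs J.swap).1 (splitPairs J.swap).2 a b *
      κ a b c d * eps c d (splitPairs I).1 (splitPairs I).2 =
      2 * κ a b (splitPairs I.swap).1 (splitPairs I.swap).2 *
        eps a b (splitPairs J.swap).1 (splitPairs J.swap).2 := by
    intro a b
    rw [sum_mul_eps_splitPairs (fun c d => eps _ _ a b * κ a b c d),
      hanti.2 a b (splitPairs I.swap).2, eps_pair_comm _ _ a b]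
    ring
  simp only [adjT, hinner]
  rw [sum_mul_eps_splitPairs (fun a b => 2 * κ a b _ _), Sum.swap_swap,
    hanti.1 (splitPairs J).2]
  ring

lemma epsPairing_mul_self : epsPairing * epsPairing = 1 := by
  simp [epsPairing, fromBlocks_multiply]

lemma idT_splitPairs (I J : Fin 3 ⊕ Fin 3) :
    idT (splitPairs J).1 (splitPairs J).2 (splitPairs I).1 (splitPairs I).2 =
      (1 : Matrix (Fin 3 ⊕ Fin 3) (Fin 3 ⊕ Fin 3) ℝ) I J := by
  rcases I with i | i <;> rcases J with j | j <;> fin_cases i <;> fin_cases j <;>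
    simp [splitPairs, idT]

lemma raisedMatrix_closure {κ : MT} (hanti : antisymMT κ) {lam : ℝ}
    (hclosure : compT κ κ = fun i j r s => -lam * idT i j r s) :
    raisedMatrix κ * epsPairing * raisedMatrix κ = -lam • epsPairing := by
  obtain ⟨M, hM⟩ : ∃ M : Matrix (Fin 3 ⊕ Fin 3) (Fin 3 ⊕ Fin 3) ℝ, M = Matrix.of fun I J =>
    κ (splitPairs J).1 (splitPairs J).2 (splitPairs I).1 (splitPairs I).2 := ⟨_, rfl⟩
  have hMM : M * M = -lam • 1 := by
    ext I J
    have h := congrFun (congrFun (congrFun (congrFun hclosure (splitPairs J).1)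
      (splitPairs J).2) (splitPairs I).1) (splitPairs I).2
    simp only [compT] at h
    rw [sum_eq_two_mul_sum_splitPairs, idT_splitPairs] at h
    · rw [Matrix.smul_apply, smul_eq_mul, ← h, hM, Matrix.mul_apply]
      simp
    · intro a b
      rw [hanti.1 a b, hanti.2 _ _ a b]
      ring
    · intro a
      have : κ a a (splitPairs I).1 (splitPairs I).2 = 0 := by
        linarith [hanti.1 a a (splitPairs I).1 (splitPairs I).2]
      rw [this, zero_mul]
  have hX : raisedMatrix κ = epsPairing * M := by rw [hM]; rfl
  calc raisedMatrix κ * epsPairing * raisedMatrix κ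
      = epsPairing * M * (epsPairing * epsPairing) * M := by rw [hX]; simp only [Matrix.mul_assoc]
    _ = -lam • epsPairing := by
      rw [epsPairing_mul_self, Matrix.mul_one, Matrix.mul_assoc, hMM, Matrix.mul_smul,
        Matrix.mul_one]

lemma antisymMT_hodge (g : Matrix (Fin 4) (Fin 4) ℝ) : antisymMT (hodge g) := by
  constructor <;> intro i j r s <;> simp only [hodge, ← mul_neg, ← Finset.sum_neg_distrib]
  · rw [Finset.sum_comm]
    refine congrArg _ (Finset.sum_congr rfl fun a _ => Finset.sum_congr rfl fun b _ => ?_)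
    rw [eps_swap_left, mul_comm (g⁻¹ j a), mul_neg]
  · refine congrArg _ (Finset.sum_congr rfl fun a _ => Finset.sum_congr rfl fun b _ => ?_)
    rw [eps_swap_right, mul_neg]

lemma raisedMatrix_hodge (g : Matrix (Fin 4) (Fin 4) ℝ) :
    raisedMatrix (hodge g) = Real.sqrt |g.det| • (compound g⁻¹)ᵀ := by
  ext I J
  rw [raisedMatrix_apply, hodge,
    sum_mul_eps_splitPairs (fun a b => g⁻¹ (splitPairs J).1 a * g⁻¹ (splitPairs J).2 b),
    Sum.swap_swap]
  simp [compound]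

/-- Pointwise Schönberg representation: a skewon-free medium tensor with
κ∘κ = −λ·Id for some λ > 0 equals f·∗_g for a Lorentz metric g and f ≠ 0. -/
theorem stmt7 (κ : MT) (hanti : antisymMT κ) (hskew : adjT κ = κ)
    (lam : ℝ) (hlam : 0 < lam)
    (hclosure : compT κ κ = fun i j r s => -lam * idT i j r s) :
    ∃ (g : Matrix (Fin 4) (Fin 4) ℝ) (f : ℝ), g.IsSymm ∧ g.det < 0 ∧ f ≠ 0 ∧
      κ = fun i j r s => f * hodge g i j r s := by
  obtain ⟨h, s, hsymm, hdet, hs, hX⟩ := isLorentzCompound_of_closure hlam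
    (raisedMatrix_isSymm hanti hskew) (raisedMatrix_closure hanti hclosure)
  have hu : IsUnit h.det := isUnit_iff_ne_zero.mpr hdet.ne
  have hgdet : h⁻¹.det < 0 := by
    rw [Matrix.det_nonsing_inv, Ring.inverse_eq_inv']
    exact inv_neg''.mpr hdet
  have hsqrt : Real.sqrt |h⁻¹.det| ≠ 0 :=
    (Real.sqrt_pos.mpr (abs_pos.mpr hgdet.ne)).ne'
  refine ⟨h⁻¹, s / Real.sqrt |h⁻¹.det|, ?_, hgdet, div_ne_zero hs hsqrt, ?_⟩
  · rw [Matrix.IsSymm, Matrix.transpose_nonsing_inv, hsymm.eq]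
  · have hanti' := antisymMT_hodge h⁻¹
    refine hanti.ext_raisedMatrix ⟨fun i j r t => ?_, fun i j r t => ?_⟩ ?_
    · simp only [hanti'.1 i j, mul_neg]
    · simp only [hanti'.2 i j r t, mul_neg]
    · have hscale : ∀ c : ℝ, raisedMatrix (fun i j r t => c * hodge h⁻¹ i j r t) =
          c • raisedMatrix (hodge h⁻¹) := by
        intro c
        ext I J
        simp only [raisedMatrix_apply, Matrix.smul_apply, smul_eq_mul]
      rw [hscale, raisedMatrix_hodge, Matrix.nonsing_inv_nonsing_inv _ hu, ← compound_transpose,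
        hsymm.eq, smul_smul, div_mul_cancel₀ _ hsqrt, hX]
end
end

section
/- (Pointwise Obukhov–Hehl conjecture, proved by Favaro–Bergamin.) Suppose κ is a skewon-free medium tensor on ℝ⁴ with tr κ = 0 (no axion part), and suppose there exists a Lorentz metric g such that the zero set of the Fresnel polynomial of κ equals the null cone N(g) (i.e., κ is non-birefringent). Then κ∘κ = −λ·Id for some real λ > 0. -/
noncomputable section
open Matrix BigOperators

/-- The twenty independent components of an algebraic curvature tensor on `ℝ⁴`; the component
`0123` is determined by the Bianchi identity. -/
structure CurvComp where
  (r0101 r0102 r0103 r0112 r0113 r0202 r0203 r0212 r0213 r0223 : ℝ)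
  (r0303 r0312 r0313 r0323 r1212 r1213 r1223 r1313 r1323 r2323 : ℝ)

/-- Components of the simple bivector `a ∧ b`. -/
def wedge (a b : Fin 4 → ℝ) (i j : Fin 4) : ℝ := a i * b j - a j * b i

/-- Contraction of the first bivector index of a curvature tensor with the bivector `B`, and of
the second one with `C`. -/
def CurvComp.onBivectors (s : CurvComp) (B C : Fin 4 → Fin 4 → ℝ) : ℝ :=
  B 0 1 * (s.r0101 * C 0 1 + s.r0102 * C 0 2 + s.r0103 * C 0 3 + s.r0112 * C 1 2
      + s.r0113 * C 1 3 + (s.r0213 - s.r0312) * C 2 3)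
  + B 0 2 * (s.r0102 * C 0 1 + s.r0202 * C 0 2 + s.r0203 * C 0 3 + s.r0212 * C 1 2
      + s.r0213 * C 1 3 + s.r0223 * C 2 3)
  + B 0 3 * (s.r0103 * C 0 1 + s.r0203 * C 0 2 + s.r0303 * C 0 3 + s.r0312 * C 1 2
      + s.r0313 * C 1 3 + s.r0323 * C 2 3)
  + B 1 2 * (s.r0112 * C 0 1 + s.r0212 * C 0 2 + s.r0312 * C 0 3 + s.r1212 * C 1 2
      + s.r1213 * C 1 3 + s.r1223 * C 2 3)
  + B 1 3 * (s.r0113 * C 0 1 + s.r0213 * C 0 2 + s.r0313 * C 0 3 + s.r1213 * C 1 2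
      + s.r1313 * C 1 3 + s.r1323 * C 2 3)
  + B 2 3 * ((s.r0213 - s.r0312) * C 0 1 + s.r0223 * C 0 2 + s.r0323 * C 0 3 + s.r1223 * C 1 2
      + s.r1323 * C 1 3 + s.r2323 * C 2 3)

/-- The curvature tensor with components `s`, as a function of four vectors. -/
def CurvComp.form (s : CurvComp) (a b c d : Fin 4 → ℝ) : ℝ :=
  s.onBivectors (wedge a b) (wedge c d)

/-- The Jacobi operator of `ξ` has a kernel which is larger than the line of `ξ`. -/
def CurvComp.IsCharacteristic (s : CurvComp) (ξ : Fin 4 → ℝ) : Prop :=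
  ∃ η, (∀ c : ℝ, η ≠ c • ξ) ∧ ∀ ζ, s.form ξ η ξ ζ = 0

/-- The standard Lorentzian quadratic form in a null frame. -/
def nullForm (ξ : Fin 4 → ℝ) : ℝ := 2 * ξ 0 * ξ 1 + ξ 2 ^ 2 + ξ 3 ^ 2

/-- The characteristic covectors are exactly the null ones. -/
def CurvComp.NonBirefringent (s : CurvComp) : Prop :=
  ∀ ξ, s.IsCharacteristic ξ ↔ nullForm ξ = 0

/-- The Gram matrix of the Jacobi operator of `ξ` on the coordinate vectors other than the
`p`-th one. -/
def CurvComp.gram (s : CurvComp) (ξ : Fin 4 → ℝ) (p : Fin 4) : Matrix (Fin 3) (Fin 3) ℝ :=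
  fun i j => s.form ξ (Pi.single (p.succAbove i) 1) ξ (Pi.single (p.succAbove j) 1)

lemma CurvComp.form_sum_right (s : CurvComp) (a b c d : Fin 4 → ℝ) :
    s.form a b c d = ∑ m, d m * s.form a b c (Pi.single m 1) := by
  simp [Fin.sum_univ_four, form, onBivectors, wedge]
  ring

lemma CurvComp.form_pair_symm (s : CurvComp) (a b c d : Fin 4 → ℝ) :
    s.form a b c d = s.form c d a b := by
  simp only [form, onBivectors]
  ring

lemma CurvComp.form_self_right (s : CurvComp) (a b c : Fin 4 → ℝ) : s.form a b c c = 0 := by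
  simp only [form, onBivectors, wedge]
  ring

lemma CurvComp.form_sum_snd (s : CurvComp) (a b c d : Fin 4 → ℝ) :
    s.form a b c d = ∑ m, b m * s.form a (Pi.single m 1) c d := by
  rw [form_pair_symm, form_sum_right]
  simp only [form_pair_symm s c d]

lemma CurvComp.form_eq_zero_of_succAbove (s : CurvComp) {ξ η : Fin 4 → ℝ} {p : Fin 4}
    (hp : ξ p ≠ 0) (h : ∀ i, s.form ξ η ξ (Pi.single (p.succAbove i) 1) = 0)
    (ζ : Fin 4 → ℝ) : s.form ξ η ξ ζ = 0 := by
  have h0 : s.form ξ η ξ (Pi.single p 1) = 0 := by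
    have := s.form_self_right ξ η ξ
    rw [form_sum_right, Fin.sum_univ_succAbove _ p] at this
    simpa [h, hp] using this
  rw [form_sum_right, Fin.sum_univ_succAbove _ p]
  simp [h, h0]

lemma CurvComp.isCharacteristic_iff (s : CurvComp) {ξ : Fin 4 → ℝ} {p : Fin 4} (hp : ξ p ≠ 0) :
    s.IsCharacteristic ξ ↔ (s.gram ξ p).det = 0 := by
  rw [← Matrix.exists_vecMul_eq_zero_iff]
  constructor
  · rintro ⟨η, hη, hk⟩
    refine ⟨fun i => η (p.succAbove i) - η p / ξ p * ξ (p.succAbove i), fun h0 => ?_, ?_⟩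
    · apply hη (η p / ξ p)
      funext m
      induction m using Fin.succAboveCases p with
      | x => simp [hp]
      | p i => simpa [sub_eq_zero] using congrFun h0 i
    · funext j
      have h1 := hk (Pi.single (p.succAbove j) 1)
      have h2 : s.form ξ ξ ξ (Pi.single (p.succAbove j) 1) = 0 := by
        rw [form_pair_symm, form_self_right]
      rw [form_sum_snd, Fin.sum_univ_succAbove _ p] at h1 h2
      simp only [Matrix.vecMul, dotProduct, gram, sub_mul, Finset.sum_sub_distrib, mul_assoc,
        ← Finset.mul_sum, Pi.zero_apply]
      field_simp
      linear_combination ξ p * h1 - η p * h2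
  · rintro ⟨v, hv, hk⟩
    refine ⟨p.insertNth 0 v, fun c hc => hv ?_, fun ζ => ?_⟩
    · have hc0 : c = 0 := by
        have := congrFun hc p
        simpa [hp] using this
      funext i
      have := congrFun hc (p.succAbove i)
      simpa [hc0] using this
    · apply s.form_eq_zero_of_succAbove hp
      intro j
      rw [form_sum_snd, Fin.sum_univ_succAbove _ p]
      simpa [Matrix.vecMul, dotProduct, gram] using congrFun hk j

/-- Symmetric bilinear forms on bivectors, as functions of four vectors. -/
structure IsBivectorForm (R : (Fin 4 → ℝ) → (Fin 4 → ℝ) → (Fin 4 → ℝ) → (Fin 4 → ℝ) → ℝ) : Prop where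
  add_left : ∀ a a' b c d, R (a + a') b c d = R a b c d + R a' b c d
  smul_left : ∀ (t : ℝ) a b c d, R (t • a) b c d = t * R a b c d
  antisymm : ∀ a b c d, R a b c d = -R b a c d
  pair_symm : ∀ a b c d, R a b c d = R c d a b

lemma IsBivectorForm.eq_wedge {R : (Fin 4 → ℝ) → (Fin 4 → ℝ) → (Fin 4 → ℝ) → (Fin 4 → ℝ) → ℝ}
    (h : IsBivectorForm R) (a b c d : Fin 4 → ℝ) :
    R a b c d = wedge a b 0 1 * R (Pi.single 0 1) (Pi.single 1 1) c d
      + wedge a b 0 2 * R (Pi.single 0 1) (Pi.single 2 1) c d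
      + wedge a b 0 3 * R (Pi.single 0 1) (Pi.single 3 1) c d
      + wedge a b 1 2 * R (Pi.single 1 1) (Pi.single 2 1) c d
      + wedge a b 1 3 * R (Pi.single 1 1) (Pi.single 3 1) c d
      + wedge a b 2 3 * R (Pi.single 2 1) (Pi.single 3 1) c d := by
  have expand : ∀ a b, R a b c d = a 0 * R (Pi.single 0 1) b c d + a 1 * R (Pi.single 1 1) b c d
      + a 2 * R (Pi.single 2 1) b c d + a 3 * R (Pi.single 3 1) b c d := by
    intro a b
    have ha : a = a 0 • Pi.single 0 1 + a 1 • Pi.single 1 1 + a 2 • Pi.single 2 1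
        + a 3 • Pi.single 3 1 := by
      funext m
      fin_cases m <;> simp
    conv_lhs => rw [ha]
    simp only [h.add_left, h.smul_left]
  have expand_snd : ∀ a, R a b c d = b 0 * R a (Pi.single 0 1) c d + b 1 * R a (Pi.single 1 1) c d
      + b 2 * R a (Pi.single 2 1) c d + b 3 * R a (Pi.single 3 1) c d := by
    intro a
    rw [h.antisymm, expand]
    simp only [h.antisymm _ a]
    ring
  have hself : ∀ a, R a a c d = 0 := fun a => by linarith [h.antisymm a a c d]
  rw [expand]
  simp only [expand_snd, hself, wedge]
  rw [h.antisymm (Pi.single 1 1) (Pi.single 0 1), h.antisymm (Pi.single 2 1) (Pi.single 0 1),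
    h.antisymm (Pi.single 3 1) (Pi.single 0 1), h.antisymm (Pi.single 2 1) (Pi.single 1 1),
    h.antisymm (Pi.single 3 1) (Pi.single 1 1), h.antisymm (Pi.single 3 1) (Pi.single 2 1)]
  ring

lemma IsBivectorForm.exists_comp {R : (Fin 4 → ℝ) → (Fin 4 → ℝ) → (Fin 4 → ℝ) → (Fin 4 → ℝ) → ℝ}
    (h : IsBivectorForm R)
    (hb : R (Pi.single 0 1) (Pi.single 1 1) (Pi.single 2 1) (Pi.single 3 1)
      + R (Pi.single 0 1) (Pi.single 2 1) (Pi.single 3 1) (Pi.single 1 1)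
      + R (Pi.single 0 1) (Pi.single 3 1) (Pi.single 1 1) (Pi.single 2 1) = 0) :
    ∃ s : CurvComp, ∀ a b c d, R a b c d = s.form a b c d := by
  let T : Fin 4 → Fin 4 → Fin 4 → Fin 4 → ℝ := fun i j k l =>
    R (Pi.single i 1) (Pi.single j 1) (Pi.single k 1) (Pi.single l 1)
  have expand : ∀ a b i j, R (Pi.single i 1) (Pi.single j 1) a b = wedge a b 0 1 * T 0 1 i j
      + wedge a b 0 2 * T 0 2 i j + wedge a b 0 3 * T 0 3 i j + wedge a b 1 2 * T 1 2 i j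
      + wedge a b 1 3 * T 1 3 i j + wedge a b 2 3 * T 2 3 i j := by
    intro a b i j
    rw [h.pair_symm, h.eq_wedge]
  have symm : ∀ i j k l, T i j k l = T k l i j := fun i j k l => h.pair_symm _ _ _ _
  have anti : ∀ i j k l, T i j k l = -T i j l k := fun i j k l => by
    rw [symm, symm i j]
    exact h.antisymm _ _ _ _
  have bianchi : T 0 1 2 3 = T 0 2 1 3 - T 0 3 1 2 := by
    have h2 := anti 0 2 3 1
    simp only [T] at *
    linarith
  refine ⟨⟨T 0 1 0 1, T 0 1 0 2, T 0 1 0 3, T 0 1 1 2, T 0 1 1 3, T 0 2 0 2, T 0 2 0 3, T 0 2 1 2,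
    T 0 2 1 3, T 0 2 2 3, T 0 3 0 3, T 0 3 1 2, T 0 3 1 3, T 0 3 2 3, T 1 2 1 2, T 1 2 1 3,
    T 1 2 2 3, T 1 3 1 3, T 1 3 2 3, T 2 3 2 3⟩, fun a b c d => ?_⟩
  rw [h.eq_wedge]
  simp only [expand, CurvComp.form, CurvComp.onBivectors]
  rw [symm 0 2 0 1, symm 0 3 0 1, symm 1 2 0 1, symm 1 3 0 1, symm 2 3 0 1, symm 0 3 0 2,
    symm 1 2 0 2, symm 1 3 0 2, symm 2 3 0 2, symm 1 2 0 3, symm 1 3 0 3, symm 2 3 0 3,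
    symm 1 3 1 2, symm 2 3 1 2, symm 2 3 1 3, bianchi]
  ring

lemma CurvComp.isBivectorForm_form (s : CurvComp) : IsBivectorForm s.form where
  add_left a a' b c d := by simp [form, onBivectors, wedge]; ring
  smul_left t a b c d := by simp [form, onBivectors, wedge]; ring
  antisymm a b c d := by simp only [form, onBivectors, wedge]; ring
  pair_symm := s.form_pair_symm

lemma CurvComp.form_bianchi (s : CurvComp) (a b c d : Fin 4 → ℝ) :
    s.form a b c d + s.form a c d b + s.form a d b c = 0 := by
  simp only [form, onBivectors, wedge]
  ring

lemma IsBivectorForm.pullback {R : (Fin 4 → ℝ) → (Fin 4 → ℝ) → (Fin 4 → ℝ) → (Fin 4 → ℝ) → ℝ}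
    (h : IsBivectorForm R) (T : (Fin 4 → ℝ) →ₗ[ℝ] (Fin 4 → ℝ)) :
    IsBivectorForm fun a b c d => R (T a) (T b) (T c) (T d) where
  add_left a a' b c d := by simp only [map_add, h.add_left]
  smul_left t a b c d := by simp only [map_smul, h.smul_left]
  antisymm a b c d := h.antisymm _ _ _ _
  pair_symm a b c d := h.pair_symm _ _ _ _

lemma CurvComp.exists_pullback (s : CurvComp) (T : (Fin 4 → ℝ) ≃ₗ[ℝ] (Fin 4 → ℝ)) :
    ∃ s' : CurvComp, (∀ a b c d, s'.form a b c d = s.form (T a) (T b) (T c) (T d)) ∧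
      ∀ ξ, s'.IsCharacteristic ξ ↔ s.IsCharacteristic (T ξ) := by
  obtain ⟨s', hs'⟩ := (s.isBivectorForm_form.pullback T.toLinearMap).exists_comp
    (s.form_bianchi _ _ _ _)
  refine ⟨s', fun a b c d => (hs' a b c d).symm, fun ξ => ⟨?_, ?_⟩⟩
  · rintro ⟨η, hη, hk⟩
    refine ⟨T η, fun c hc => hη c (T.injective (by rw [hc, map_smul])), fun ζ => ?_⟩
    have := hk (T.symm ζ)
    rw [← hs'] at this
    simpa using this
  · rintro ⟨η, hη, hk⟩
    refine ⟨T.symm η, fun c hc => hη c ?_, fun ζ => ?_⟩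
    · rw [← map_smul, ← hc, T.apply_symm_apply]
    · rw [← hs']
      simpa using hk (T ζ)

lemma CurvComp.NonBirefringent.exists_pullback {s : CurvComp} (hs : s.NonBirefringent)
    (T : (Fin 4 → ℝ) ≃ₗ[ℝ] (Fin 4 → ℝ)) (hT : ∀ ξ, nullForm (T ξ) = nullForm ξ) :
    ∃ s' : CurvComp, s'.NonBirefringent ∧
      ∀ a b c d, s'.form a b c d = s.form (T a) (T b) (T c) (T d) := by
  obtain ⟨s', h1, h2⟩ := s.exists_pullback T
  exact ⟨s', fun ξ => by rw [h2, hs, hT], h1⟩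

/-- Exchange of the two null vectors of a null frame. -/
def nullSwap : (Fin 4 → ℝ) ≃ₗ[ℝ] (Fin 4 → ℝ) :=
  LinearEquiv.funCongrLeft ℝ ℝ (Equiv.swap 0 1)

/-- Exchange of the two spacelike vectors of a null frame. -/
def spaceSwap : (Fin 4 → ℝ) ≃ₗ[ℝ] (Fin 4 → ℝ) :=
  LinearEquiv.funCongrLeft ℝ ℝ (Equiv.swap 2 3)

/-- The null rotations fixing the second null vector of a null frame. -/
def nullRot (u v : ℝ) : (Fin 4 → ℝ) ≃ₗ[ℝ] (Fin 4 → ℝ) where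
  toFun ξ := ![ξ 0, ξ 1 - (u ^ 2 + v ^ 2) / 2 * ξ 0 - u * ξ 2 - v * ξ 3, ξ 2 + u * ξ 0,
    ξ 3 + v * ξ 0]
  invFun ξ := ![ξ 0, ξ 1 - (u ^ 2 + v ^ 2) / 2 * ξ 0 + u * ξ 2 + v * ξ 3, ξ 2 - u * ξ 0,
    ξ 3 - v * ξ 0]
  map_add' ξ η := by
    funext m
    fin_cases m <;> simp <;> ring
  map_smul' c ξ := by
    funext m
    fin_cases m <;> simp <;> ring
  left_inv ξ := by
    funext m
    fin_cases m <;> simp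
    ring
  right_inv ξ := by
    funext m
    fin_cases m <;> simp
    ring

lemma nullSwap_apply (ξ : Fin 4 → ℝ) : nullSwap ξ = ![ξ 1, ξ 0, ξ 2, ξ 3] := by
  funext m
  fin_cases m <;> rfl

lemma spaceSwap_apply (ξ : Fin 4 → ℝ) : spaceSwap ξ = ![ξ 0, ξ 1, ξ 3, ξ 2] := by
  funext m
  fin_cases m <;> rfl

lemma nullRot_apply (u v : ℝ) (ξ : Fin 4 → ℝ) : nullRot u v ξ =
    ![ξ 0, ξ 1 - (u ^ 2 + v ^ 2) / 2 * ξ 0 - u * ξ 2 - v * ξ 3, ξ 2 + u * ξ 0,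
      ξ 3 + v * ξ 0] := rfl

lemma nullForm_nullSwap (ξ : Fin 4 → ℝ) : nullForm (nullSwap ξ) = nullForm ξ := by
  simp [nullSwap_apply, nullForm]
  ring

lemma nullForm_spaceSwap (ξ : Fin 4 → ℝ) : nullForm (spaceSwap ξ) = nullForm ξ := by
  simp [spaceSwap_apply, nullForm]
  ring

lemma nullForm_nullRot (u v : ℝ) (ξ : Fin 4 → ℝ) : nullForm (nullRot u v ξ) = nullForm ξ := by
  simp [nullRot_apply, nullForm]
  ring

/-- The null rotations fixing the first null vector of a null frame. -/
def nullRotFst (u v : ℝ) : (Fin 4 → ℝ) ≃ₗ[ℝ] (Fin 4 → ℝ) :=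
  nullSwap.trans ((nullRot u v).trans nullSwap)

lemma nullRotFst_apply (u v : ℝ) (ξ : Fin 4 → ℝ) : nullRotFst u v ξ =
    ![ξ 0 - (u ^ 2 + v ^ 2) / 2 * ξ 1 - u * ξ 2 - v * ξ 3, ξ 1, ξ 2 + u * ξ 1,
      ξ 3 + v * ξ 1] := by
  simp [nullRotFst, nullSwap_apply, nullRot_apply]

lemma nullForm_nullRotFst (u v : ℝ) (ξ : Fin 4 → ℝ) :
    nullForm (nullRotFst u v ξ) = nullForm ξ := by
  simp [nullRotFst, nullForm_nullSwap, nullForm_nullRot]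

namespace CurvComp

variable {s : CurvComp}

lemma NonBirefringent.gram_det_ne_zero (hs : s.NonBirefringent) {ξ : Fin 4 → ℝ} {p : Fin 4}
    (hp : ξ p ≠ 0) (hξ : nullForm ξ ≠ 0) : (s.gram ξ p).det ≠ 0 :=
  fun h => hξ ((hs ξ).1 ((s.isCharacteristic_iff hp).2 h))

lemma gram_zero_det (s : CurvComp) (ξ : Fin 4 → ℝ) : (s.gram ξ 0).det =
    s.form ξ ![0, 1, 0, 0] ξ ![0, 1, 0, 0] * (s.form ξ ![0, 0, 1, 0] ξ ![0, 0, 1, 0]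
        * s.form ξ ![0, 0, 0, 1] ξ ![0, 0, 0, 1] - s.form ξ ![0, 0, 1, 0] ξ ![0, 0, 0, 1] ^ 2)
      - s.form ξ ![0, 1, 0, 0] ξ ![0, 0, 1, 0] * (s.form ξ ![0, 1, 0, 0] ξ ![0, 0, 1, 0]
        * s.form ξ ![0, 0, 0, 1] ξ ![0, 0, 0, 1]
        - s.form ξ ![0, 0, 1, 0] ξ ![0, 0, 0, 1] * s.form ξ ![0, 1, 0, 0] ξ ![0, 0, 0, 1])
      + s.form ξ ![0, 1, 0, 0] ξ ![0, 0, 0, 1] * (s.form ξ ![0, 1, 0, 0] ξ ![0, 0, 1, 0]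
        * s.form ξ ![0, 0, 1, 0] ξ ![0, 0, 0, 1]
        - s.form ξ ![0, 0, 1, 0] ξ ![0, 0, 1, 0] * s.form ξ ![0, 1, 0, 0] ξ ![0, 0, 0, 1]) := by
  have h1 : Pi.single ((0 : Fin 4).succAbove 0) (1 : ℝ) = ![0, 1, 0, 0] := by
    funext m; fin_cases m <;> rfl
  have h2 : Pi.single ((0 : Fin 4).succAbove 1) (1 : ℝ) = ![0, 0, 1, 0] := by
    funext m; fin_cases m <;> rfl
  have h3 : Pi.single ((0 : Fin 4).succAbove 2) (1 : ℝ) = ![0, 0, 0, 1] := by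
    funext m; fin_cases m <;> rfl
  rw [Matrix.det_fin_three]
  simp only [gram, h1, h2, h3]
  rw [s.form_pair_symm ξ ![0, 0, 1, 0] ξ ![0, 1, 0, 0],
    s.form_pair_symm ξ ![0, 0, 0, 1] ξ ![0, 1, 0, 0],
    s.form_pair_symm ξ ![0, 0, 0, 1] ξ ![0, 0, 1, 0]]
  ring

lemma continuous_form {X : Type*} [TopologicalSpace X] (s : CurvComp) {a b c d : X → Fin 4 → ℝ}
    (ha : Continuous a) (hb : Continuous b) (hc : Continuous c) (hd : Continuous d) :
    Continuous fun x => s.form (a x) (b x) (c x) (d x) := by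
  simp only [form, onBivectors, wedge]
  fun_prop

lemma continuous_gram_zero_det (s : CurvComp) : Continuous fun ξ => (s.gram ξ 0).det := by
  simp only [gram_zero_det]
  have := fun b d : Fin 4 → ℝ => s.continuous_form (X := Fin 4 → ℝ) continuous_id
    (continuous_const (y := b)) continuous_id (continuous_const (y := d))
  simp only [id] at this
  fun_prop

lemma eq_zero_of_forall_nonneg {c : ℝ} {g : ℝ → ℝ} (hg : Continuous g)
    (h : ∀ t, 0 ≤ t * (c + t * g t)) : c = 0 := by
  have hc : Filter.Tendsto (fun t => c + t * g t) (nhds 0) (nhds c) := by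
    have : Continuous fun t => c + t * g t := by fun_prop
    simpa using this.tendsto 0
  apply le_antisymm
  · refine le_of_tendsto (hc.mono_left (nhdsWithin_le_nhds (s := Set.Iio 0))) ?_
    filter_upwards [self_mem_nhdsWithin] with t ht
    have ht' : t < 0 := ht
    nlinarith [h t]
  · refine ge_of_tendsto (hc.mono_left (nhdsWithin_le_nhds (s := Set.Ioi 0))) ?_
    filter_upwards [self_mem_nhdsWithin] with t ht
    exact (mul_nonneg_iff_of_pos_left ht).1 (h t)

/-- On a half-plane of non-null covectors the determinant has constant sign, hence it has
constant sign on the boundary. -/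
lemma NonBirefringent.gram_det_sign (hs : s.NonBirefringent) :
    (∀ t : ℝ, 0 ≤ (s.gram ![1, 0, t, 0] 0).det) ∨ ∀ t : ℝ, (s.gram ![1, 0, t, 0] 0).det ≤ 0 := by
  let f : ℝ × ℝ → ℝ := fun p => (s.gram ![1, p.1, p.2, 0] 0).det
  have hf : Continuous f := by
    apply s.continuous_gram_zero_det.comp (f := fun p : ℝ × ℝ => ![1, p.1, p.2, 0])
    refine continuous_pi fun m => ?_
    fin_cases m <;> simp <;> fun_prop
  have hne : ∀ p ∈ Set.Ioi (0 : ℝ) ×ˢ (Set.univ : Set ℝ), f p ≠ 0 := by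
    rintro ⟨τ, t⟩ ⟨hτ, -⟩
    refine hs.gram_det_ne_zero (by simp) (ne_of_gt ?_)
    have : 0 < τ := hτ
    simp [nullForm]
    positivity
  have hconn : IsPreconnected (Set.Ioi (0 : ℝ) ×ˢ (Set.univ : Set ℝ)) :=
    isPreconnected_Ioi.prod isPreconnected_univ
  have hlim : ∀ t : ℝ, Filter.Tendsto (fun τ => f (τ, t)) (nhdsWithin 0 (Set.Ioi 0))
      (nhds (f (0, t))) := fun t =>
    ((hf.comp (by fun_prop : Continuous fun τ : ℝ => (τ, t))).tendsto 0).mono_left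
      nhdsWithin_le_nhds
  by_cases hpos : ∃ p ∈ Set.Ioi (0 : ℝ) ×ˢ (Set.univ : Set ℝ), 0 < f p
  · left
    obtain ⟨p, hp, hfp⟩ := hpos
    intro t
    refine ge_of_tendsto (hlim t) ?_
    filter_upwards [self_mem_nhdsWithin] with τ hτ
    by_contra! hneg
    obtain ⟨r, hr, hr0⟩ := hconn.intermediate_value (a := (τ, t)) (b := p) ⟨hτ, trivial⟩ hp
      hf.continuousOn ⟨hneg.le, hfp.le⟩
    exact hne r hr hr0
  · right
    push Not at hpos
    intro t
    refine le_of_tendsto (hlim t) ?_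
    filter_upwards [self_mem_nhdsWithin] with τ hτ
    exact hpos _ ⟨hτ, trivial⟩

lemma NonBirefringent.tangent_mul_disc_eq_zero (hs : s.NonBirefringent) (h1 : s.r0101 = 0)
    (h2 : s.r0102 = 0) (h3 : s.r0103 = 0) :
    s.r0112 * (s.r0202 * s.r0303 - s.r0203 ^ 2) = 0 := by
  obtain ⟨g, hg, key⟩ : ∃ g : ℝ → ℝ, Continuous g ∧ ∀ t : ℝ, (s.gram ![1, 0, t, 0] 0).det =
      t * (-2 * (s.r0112 * (s.r0202 * s.r0303 - s.r0203 ^ 2)) + t * g t) := by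
    refine ⟨fun t => -4*s.r0112*s.r0202*s.r0323 + 4*s.r0112*s.r0203*s.r0223
        + s.r0202*s.r0303*s.r1212
        - s.r0203^2*s.r1212 - s.r0212^2*s.r0303 - 2*s.r0203*s.r0212*s.r0213
        + 4*s.r0203*s.r0212*s.r0312 - s.r0202*s.r0213^2 + 4*s.r0202*s.r0213*s.r0312
        - 4*s.r0202*s.r0312^2
        + t * (-2*s.r0112*s.r0202*s.r2323 + 2*s.r0112*s.r0223^2 + 2*s.r0202*s.r0323*s.r1212
        - 2*s.r0203*s.r0223*s.r1212 - 2*s.r0212^2*s.r0323 + 2*s.r0203*s.r0212*s.r1223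
        - 2*s.r0212*s.r0213*s.r0223 + 4*s.r0212*s.r0223*s.r0312 + 2*s.r0202*s.r0213*s.r1223
        - 4*s.r0202*s.r0312*s.r1223)
        + t ^ 2 * (s.r0202*s.r1212*s.r2323 - s.r0223^2*s.r1212 - s.r0212^2*s.r2323
        + 2*s.r0212*s.r0223*s.r1223 - s.r0202*s.r1223^2), by fun_prop, fun t => ?_⟩
    rw [gram_zero_det]
    simp [form, onBivectors, wedge, h1, h2, h3]
    ring
  rcases hs.gram_det_sign with h | h
  · have := eq_zero_of_forall_nonneg hg (fun t => (h t).trans_eq (key t))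
    linarith
  · have := eq_zero_of_forall_nonneg (c := 2 * (s.r0112 * (s.r0202 * s.r0303 - s.r0203 ^ 2)))
      (g := fun t => -g t) hg.neg (fun t => by linarith [h t, key t])
    linarith

end CurvComp

/-- The symmetric bilinear form of `nullForm`. -/
def nullPolar (a b : Fin 4 → ℝ) : ℝ := a 0 * b 1 + a 1 * b 0 + a 2 * b 2 + a 3 * b 3

lemma nullPolar_map {T : (Fin 4 → ℝ) ≃ₗ[ℝ] (Fin 4 → ℝ)} (hT : ∀ ξ, nullForm (T ξ) = nullForm ξ)
    (a b : Fin 4 → ℝ) : nullPolar (T a) (T b) = nullPolar a b := by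
  have key : ∀ a b, 2 * nullPolar a b = nullForm (a + b) - nullForm a - nullForm b := by
    intro a b
    simp [nullPolar, nullForm]
    ring
  have h1 := key (T a) (T b)
  rw [← map_add, hT, hT, hT, ← key] at h1
  linarith

/-- The curvature tensor is that of a space of constant curvature. -/
def CurvComp.IsConstCurv (s : CurvComp) : Prop :=
  ∃ Λ : ℝ, ∀ a b c d, s.form a b c d =
    Λ * (nullPolar a c * nullPolar b d - nullPolar a d * nullPolar b c)

namespace CurvComp

variable {s : CurvComp}

lemma NonBirefringent.exists_isometric_pullback (hs : s.NonBirefringent)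
    {T : (Fin 4 → ℝ) ≃ₗ[ℝ] (Fin 4 → ℝ)} (hT : ∀ ξ, nullForm (T ξ) = nullForm ξ) :
    ∃ s' : CurvComp, s'.NonBirefringent ∧ (s'.IsConstCurv → s.IsConstCurv) ∧
      ∀ a b c d, s'.form a b c d = s.form (T a) (T b) (T c) (T d) := by
  obtain ⟨s', h1, h2⟩ := hs.exists_pullback T hT
  refine ⟨s', h1, ?_, h2⟩
  rintro ⟨Λ, hΛ⟩
  refine ⟨Λ, fun a b c d => ?_⟩
  have key : ∀ a b, nullPolar (T.symm a) (T.symm b) = nullPolar a b := fun a b => by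
    rw [← nullPolar_map hT, T.apply_symm_apply, T.apply_symm_apply]
  simpa only [h2, key, T.apply_symm_apply] using hΛ (T.symm a) (T.symm b) (T.symm c) (T.symm d)

lemma NonBirefringent.disc_eq_zero_of_kernel (hs : s.NonBirefringent) (h1 : s.r0101 = 0)
    (h2 : s.r0102 = 0) (h3 : s.r0103 = 0) : s.r0202 * s.r0303 - s.r0203 ^ 2 = 0 := by
  by_contra hD
  have h4 : s.r0112 = 0 := by
    simpa [hD] using hs.tangent_mul_disc_eq_zero h1 h2 h3
  have h5 : s.r0113 = 0 := by
    obtain ⟨s', hs', -, hT⟩ := hs.exists_isometric_pullback nullForm_spaceSwap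
    have e1 := hT ![1, 0, 0, 0] ![0, 1, 0, 0] ![1, 0, 0, 0] ![0, 1, 0, 0]
    have e2 := hT ![1, 0, 0, 0] ![0, 1, 0, 0] ![1, 0, 0, 0] ![0, 0, 1, 0]
    have e3 := hT ![1, 0, 0, 0] ![0, 1, 0, 0] ![1, 0, 0, 0] ![0, 0, 0, 1]
    have e4 := hT ![1, 0, 0, 0] ![0, 1, 0, 0] ![0, 1, 0, 0] ![0, 0, 1, 0]
    have e5 := hT ![1, 0, 0, 0] ![0, 0, 1, 0] ![1, 0, 0, 0] ![0, 0, 1, 0]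
    have e6 := hT ![1, 0, 0, 0] ![0, 0, 1, 0] ![1, 0, 0, 0] ![0, 0, 0, 1]
    have e7 := hT ![1, 0, 0, 0] ![0, 0, 0, 1] ![1, 0, 0, 0] ![0, 0, 0, 1]
    simp [form, onBivectors, wedge, spaceSwap_apply] at e1 e2 e3 e4 e5 e6 e7
    have := hs'.tangent_mul_disc_eq_zero (e1.trans h1) (e2.trans h3) (e3.trans h2)
    rw [e4, e5, e6, e7] at this
    rcases mul_eq_zero.1 this with h | h
    · exact h
    · exact absurd (by linarith) hD
  have hchar : s.IsCharacteristic ![1, 1, 0, 0] := by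
    refine ⟨![0, 1, 0, 0], fun c hc => ?_, fun ζ => ?_⟩
    · have hc0 := congrFun hc 0
      have hc1 := congrFun hc 1
      simp at hc0 hc1
      linarith
    · simp [form, onBivectors, wedge, h1, h2, h3, h4, h5]
  have := (hs _).1 hchar
  simp [nullForm] at this

lemma NonBirefringent.disc_eq_zero (hs : s.NonBirefringent) :
    s.r0202 * s.r0303 - s.r0203 ^ 2 = 0 := by
  by_contra hD
  obtain ⟨η, hη, hk⟩ := (hs ![1, 0, 0, 0]).2 (by simp [nullForm])
  have k1 := hk ![0, 1, 0, 0]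
  have k2 := hk ![0, 0, 1, 0]
  have k3 := hk ![0, 0, 0, 1]
  simp [form, onBivectors, wedge] at k1 k2 k3
  have hη1 : η 1 ≠ 0 := by
    intro h
    simp only [h, zero_mul, zero_add] at k2 k3
    have e2 : η 2 = 0 := by
      have : (s.r0202 * s.r0303 - s.r0203 ^ 2) * η 2 = 0 := by
        linear_combination s.r0303 * k2 - s.r0203 * k3
      simpa [hD] using this
    have e3 : η 3 = 0 := by
      have : (s.r0202 * s.r0303 - s.r0203 ^ 2) * η 3 = 0 := by
        linear_combination s.r0202 * k3 - s.r0203 * k2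
      simpa [hD] using this
    apply hη (η 0)
    funext m
    fin_cases m <;> simp [h, e2, e3]
  obtain ⟨s', hs', -, hT⟩ :=
    hs.exists_isometric_pullback (nullForm_nullRotFst (η 2 / η 1) (η 3 / η 1))
  have e1 := hT ![1, 0, 0, 0] ![0, 1, 0, 0] ![1, 0, 0, 0] ![0, 1, 0, 0]
  have e2 := hT ![1, 0, 0, 0] ![0, 1, 0, 0] ![1, 0, 0, 0] ![0, 0, 1, 0]
  have e3 := hT ![1, 0, 0, 0] ![0, 1, 0, 0] ![1, 0, 0, 0] ![0, 0, 0, 1]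
  have e5 := hT ![1, 0, 0, 0] ![0, 0, 1, 0] ![1, 0, 0, 0] ![0, 0, 1, 0]
  have e6 := hT ![1, 0, 0, 0] ![0, 0, 1, 0] ![1, 0, 0, 0] ![0, 0, 0, 1]
  have e7 := hT ![1, 0, 0, 0] ![0, 0, 0, 1] ![1, 0, 0, 0] ![0, 0, 0, 1]
  simp [form, onBivectors, wedge, nullRotFst_apply] at e1 e2 e3 e5 e6 e7
  have := hs'.disc_eq_zero_of_kernel
    (e1.trans (by
      field_simp
      linear_combination η 1 * k1 + η 2 * k2 + η 3 * k3))
    (e2.trans (by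
      field_simp
      linear_combination k2))
    (e3.trans (by
      field_simp
      linear_combination k3))
  rw [e5, e6, e7] at this
  exact hD this

/-- Real part of the Weyl spinor polynomial at the point `u + i v` of the celestial sphere. -/
def weylRe (s : CurvComp) (u v : ℝ) : ℝ :=
  (s.r0202 - s.r0303) + (-2 * (s.r0102 + s.r0323) * u + 2 * (s.r0103 - s.r0223) * v)
    + ((s.r0101 + s.r0212 + s.r0313 - s.r2323) * (u ^ 2 - v ^ 2)
      + 6 * (s.r0213 - s.r0312) * (u * v))
    + ((s.r1323 - s.r0112) * (u ^ 3 - 3 * u * v ^ 2)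
      - (s.r0113 + s.r1223) * (3 * u ^ 2 * v - v ^ 3))
    + ((s.r1212 - s.r1313) / 4 * (u ^ 4 - 6 * u ^ 2 * v ^ 2 + v ^ 4)
      + 2 * s.r1213 * (u ^ 3 * v - u * v ^ 3))

/-- Imaginary part of the Weyl spinor polynomial at the point `u + i v`. -/
def weylIm (s : CurvComp) (u v : ℝ) : ℝ :=
  2 * s.r0203 + (-2 * (s.r0103 - s.r0223) * u - 2 * (s.r0102 + s.r0323) * v)
    + (-3 * (s.r0213 - s.r0312) * (u ^ 2 - v ^ 2)
      + 2 * (s.r0101 + s.r0212 + s.r0313 - s.r2323) * (u * v))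
    + ((s.r0113 + s.r1223) * (u ^ 3 - 3 * u * v ^ 2)
      + (s.r1323 - s.r0112) * (3 * u ^ 2 * v - v ^ 3))
    + (-(s.r1213 / 2) * (u ^ 4 - 6 * u ^ 2 * v ^ 2 + v ^ 4)
      + (s.r1212 - s.r1313) * (u ^ 3 * v - u * v ^ 3))

/-- The trace-free Ricci spinor polynomial at the point `u + i v`. -/
def ricci (s : CurvComp) (u v : ℝ) : ℝ :=
  (s.r0202 + s.r0303) + (-2 * (s.r0102 - s.r0323) * u - 2 * (s.r0103 + s.r0223) * v)
    + ((s.r0101 + s.r2323) * (u ^ 2 + v ^ 2) + (s.r0212 - s.r0313) * (u ^ 2 - v ^ 2)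
      + 2 * (s.r0213 + s.r0312) * (u * v))
    - (u ^ 2 + v ^ 2) * ((s.r0112 + s.r1323) * u + (s.r0113 - s.r1223) * v)
    + (s.r1212 + s.r1313) / 4 * (u ^ 2 + v ^ 2) ^ 2

lemma form_nullRot_sub (s : CurvComp) (u v : ℝ) :
    s.form (nullRot u v ![1, 0, 0, 0]) (nullRot u v ![0, 0, 1, 0]) (nullRot u v ![1, 0, 0, 0])
        (nullRot u v ![0, 0, 1, 0])
      - s.form (nullRot u v ![1, 0, 0, 0]) (nullRot u v ![0, 0, 0, 1])
        (nullRot u v ![1, 0, 0, 0]) (nullRot u v ![0, 0, 0, 1]) = s.weylRe u v := by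
  simp [form, onBivectors, wedge, nullRot_apply, weylRe]
  ring

lemma form_nullRot_add (s : CurvComp) (u v : ℝ) :
    s.form (nullRot u v ![1, 0, 0, 0]) (nullRot u v ![0, 0, 1, 0]) (nullRot u v ![1, 0, 0, 0])
        (nullRot u v ![0, 0, 1, 0])
      + s.form (nullRot u v ![1, 0, 0, 0]) (nullRot u v ![0, 0, 0, 1])
        (nullRot u v ![1, 0, 0, 0]) (nullRot u v ![0, 0, 0, 1]) = s.ricci u v := by
  simp [form, onBivectors, wedge, nullRot_apply, ricci]
  ring

lemma form_nullRot_mixed (s : CurvComp) (u v : ℝ) :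
    2 * s.form (nullRot u v ![1, 0, 0, 0]) (nullRot u v ![0, 0, 1, 0])
      (nullRot u v ![1, 0, 0, 0]) (nullRot u v ![0, 0, 0, 1]) = s.weylIm u v := by
  simp [form, onBivectors, wedge, nullRot_apply, weylIm]
  ring

lemma NonBirefringent.exists_nullRot (hs : s.NonBirefringent) (u v : ℝ) :
    ∃ s' : CurvComp, s'.NonBirefringent ∧ (s'.IsConstCurv → s.IsConstCurv) ∧
      s'.r0202 - s'.r0303 = s.weylRe u v ∧ s'.r0202 + s'.r0303 = s.ricci u v ∧
      2 * s'.r0203 = s.weylIm u v := by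
  obtain ⟨s', hs', hc, hT⟩ := hs.exists_isometric_pullback (nullForm_nullRot u v)
  have e1 : s'.r0202 = s'.form ![1, 0, 0, 0] ![0, 0, 1, 0] ![1, 0, 0, 0] ![0, 0, 1, 0] := by
    simp [form, onBivectors, wedge]
  have e2 : s'.r0203 = s'.form ![1, 0, 0, 0] ![0, 0, 1, 0] ![1, 0, 0, 0] ![0, 0, 0, 1] := by
    simp [form, onBivectors, wedge]
  have e3 : s'.r0303 = s'.form ![1, 0, 0, 0] ![0, 0, 0, 1] ![1, 0, 0, 0] ![0, 0, 0, 1] := by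
    simp [form, onBivectors, wedge]
  refine ⟨s', hs', hc, ?_, ?_, ?_⟩
  · rw [e1, e3, hT, hT, form_nullRot_sub]
  · rw [e1, e3, hT, hT, form_nullRot_add]
  · rw [e2, hT, form_nullRot_mixed]

lemma NonBirefringent.ricci_sq (hs : s.NonBirefringent) (u v : ℝ) :
    s.ricci u v ^ 2 = s.weylRe u v ^ 2 + s.weylIm u v ^ 2 := by
  obtain ⟨s', hs', -, h1, h2, h3⟩ := hs.exists_nullRot u v
  rw [← h1, ← h2, ← h3]
  linear_combination 4 * hs'.disc_eq_zero

/-- Unless its leading coefficient vanishes, the Weyl spinor polynomial has a root. -/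
lemma exists_weyl_root (h : ¬(s.r1212 = s.r1313 ∧ s.r1213 = 0)) :
    ∃ u v, s.weylRe u v = 0 ∧ s.weylIm u v = 0 := by
  let p : Polynomial ℂ := .C ⟨s.r0202 - s.r0303, 2 * s.r0203⟩
    + .C ⟨-2 * (s.r0102 + s.r0323), -2 * (s.r0103 - s.r0223)⟩ * .X
    + .C ⟨s.r0101 + s.r0212 + s.r0313 - s.r2323, -3 * (s.r0213 - s.r0312)⟩ * .X ^ 2
    + .C ⟨s.r1323 - s.r0112, s.r0113 + s.r1223⟩ * .X ^ 3
    + .C ⟨(s.r1212 - s.r1313) / 4, -(s.r1213 / 2)⟩ * .X ^ 4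
  have hp : 0 < p.degree := by
    by_contra! hle
    have h4 : p.coeff 4 = 0 :=
      Polynomial.coeff_eq_zero_of_degree_lt (hle.trans_lt (by norm_num))
    simp [p] at h4
    rw [Complex.ext_iff] at h4
    simp at h4
    exact h ⟨by linarith [h4.1], h4.2⟩
  obtain ⟨z, hz⟩ := Complex.exists_root hp
  simp only [p, Polynomial.IsRoot, Polynomial.eval_add, Polynomial.eval_mul, Polynomial.eval_C,
    Polynomial.eval_X, Polynomial.eval_pow] at hz
  rw [Complex.ext_iff] at hz
  simp [pow_succ] at hz
  refine ⟨z.re, z.im, ?_, ?_⟩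
  · rw [weylRe]
    linear_combination hz.1
  · rw [weylIm]
    linear_combination hz.2

lemma NonBirefringent.exists_principal (hs : s.NonBirefringent) :
    ∃ s' : CurvComp, s'.NonBirefringent ∧ (s'.IsConstCurv → s.IsConstCurv) ∧
      s'.r0202 = 0 ∧ s'.r0203 = 0 ∧ s'.r0303 = 0 := by
  obtain ⟨s', hs', hc, h1, h2⟩ : ∃ s' : CurvComp, s'.NonBirefringent ∧
      (s'.IsConstCurv → s.IsConstCurv) ∧ s'.r0202 = s'.r0303 ∧ s'.r0203 = 0 := by
    by_cases h : s.r1212 = s.r1313 ∧ s.r1213 = 0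
    · obtain ⟨s', hs', hc, hT⟩ := hs.exists_isometric_pullback nullForm_nullSwap
      have e1 := hT ![1, 0, 0, 0] ![0, 0, 1, 0] ![1, 0, 0, 0] ![0, 0, 1, 0]
      have e2 := hT ![1, 0, 0, 0] ![0, 0, 1, 0] ![1, 0, 0, 0] ![0, 0, 0, 1]
      have e3 := hT ![1, 0, 0, 0] ![0, 0, 0, 1] ![1, 0, 0, 0] ![0, 0, 0, 1]
      simp [form, onBivectors, wedge, nullSwap_apply] at e1 e2 e3
      exact ⟨s', hs', hc, by rw [e1, e3, h.1], by rw [e2, h.2]⟩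
    · obtain ⟨u, v, hu, hv⟩ := exists_weyl_root h
      obtain ⟨s', hs', hc, h1, -, h3⟩ := hs.exists_nullRot u v
      exact ⟨s', hs', hc, by linarith, by linarith⟩
  have hD := hs'.disc_eq_zero
  have h3 : s'.r0303 = 0 := by
    rw [h1, h2] at hD
    simpa using hD
  exact ⟨s', hs', hc, h1.trans h3, h2, h3⟩

end CurvComp

/-- Comparison of coefficients in an identity between squares of quartic polynomials. -/
lemma sq_eq_sq_add_sq_coeffs {f₁ f₂ f₃ f₄ a₁ a₂ a₃ a₄ b₁ b₂ b₃ b₄ : ℝ}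
    (h : ∀ t : ℝ, (f₁ * t + f₂ * t ^ 2 + f₃ * t ^ 3 + f₄ * t ^ 4) ^ 2 =
      (a₁ * t + a₂ * t ^ 2 + a₃ * t ^ 3 + a₄ * t ^ 4) ^ 2
        + (b₁ * t + b₂ * t ^ 2 + b₃ * t ^ 3 + b₄ * t ^ 4) ^ 2) :
    f₁ ^ 2 = a₁ ^ 2 + b₁ ^ 2 ∧
      2 * f₁ * f₃ + f₂ ^ 2 = 2 * a₁ * a₃ + a₂ ^ 2 + (2 * b₁ * b₃ + b₂ ^ 2) ∧
      f₁ * f₄ + f₂ * f₃ = a₁ * a₄ + a₂ * a₃ + (b₁ * b₄ + b₂ * b₃) ∧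
      2 * f₂ * f₄ + f₃ ^ 2 = 2 * a₂ * a₄ + a₃ ^ 2 + (2 * b₂ * b₄ + b₃ ^ 2) ∧
      f₄ ^ 2 = a₄ ^ 2 + b₄ ^ 2 := by
  have h1 := h 1
  have h2 := h (-1)
  have h3 := h 2
  have h4 := h (-2)
  have h5 := h 3
  have h6 := h (-3)
  have h7 := h 4
  ring_nf at h1 h2 h3 h4 h5 h6 h7
  refine ⟨?_, ?_, ?_, ?_, ?_⟩ <;> linarith

/-- A linear form on the plane whose square is a multiple of the Euclidean form vanishes. -/
lemma eq_zero_of_linear_sq {x y c : ℝ} (h : ∀ u v : ℝ, (x * u + y * v) ^ 2 = c * (u ^ 2 + v ^ 2)) :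
    x = 0 ∧ y = 0 ∧ c = 0 := by
  have h1 := h 1 0
  have h2 := h 0 1
  have h3 := h 1 1
  have h4 : x * y = 0 := by linarith
  have hc : c = 0 := by
    rcases mul_eq_zero.1 h4 with h | h <;> subst h <;> linarith
  subst hc
  simp at h1 h2
  exact ⟨h1, h2, rfl⟩

namespace CurvComp

variable {s : CurvComp}

lemma NonBirefringent.first_order_eq_zero (hs : s.NonBirefringent) (h1 : s.r0202 = 0)
    (h2 : s.r0203 = 0) (h3 : s.r0303 = 0) :
    s.r0102 = 0 ∧ s.r0103 = 0 ∧ s.r0223 = 0 ∧ s.r0323 = 0 := by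
  obtain ⟨e1, e2, e3⟩ : s.r0102 - s.r0323 = 0 ∧ s.r0103 + s.r0223 = 0 ∧
      (s.r0102 + s.r0323) ^ 2 + (s.r0103 - s.r0223) ^ 2 = 0 := by
    apply eq_zero_of_linear_sq
    intro u v
    have := (sq_eq_sq_add_sq_coeffs
      (f₁ := -2 * (s.r0102 - s.r0323) * u - 2 * (s.r0103 + s.r0223) * v)
      (f₂ := (s.r0101 + s.r2323) * (u ^ 2 + v ^ 2) + (s.r0212 - s.r0313) * (u ^ 2 - v ^ 2)
        + 2 * (s.r0213 + s.r0312) * (u * v))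
      (f₃ := -((u ^ 2 + v ^ 2) * ((s.r0112 + s.r1323) * u + (s.r0113 - s.r1223) * v)))
      (f₄ := (s.r1212 + s.r1313) / 4 * (u ^ 2 + v ^ 2) ^ 2)
      (a₁ := -2 * (s.r0102 + s.r0323) * u + 2 * (s.r0103 - s.r0223) * v)
      (a₂ := (s.r0101 + s.r0212 + s.r0313 - s.r2323) * (u ^ 2 - v ^ 2)
        + 6 * (s.r0213 - s.r0312) * (u * v))
      (a₃ := (s.r1323 - s.r0112) * (u ^ 3 - 3 * u * v ^ 2)
        - (s.r0113 + s.r1223) * (3 * u ^ 2 * v - v ^ 3))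
      (a₄ := (s.r1212 - s.r1313) / 4 * (u ^ 4 - 6 * u ^ 2 * v ^ 2 + v ^ 4)
        + 2 * s.r1213 * (u ^ 3 * v - u * v ^ 3))
      (b₁ := -2 * (s.r0103 - s.r0223) * u - 2 * (s.r0102 + s.r0323) * v)
      (b₂ := -3 * (s.r0213 - s.r0312) * (u ^ 2 - v ^ 2)
        + 2 * (s.r0101 + s.r0212 + s.r0313 - s.r2323) * (u * v))
      (b₃ := (s.r0113 + s.r1223) * (u ^ 3 - 3 * u * v ^ 2)
        + (s.r1323 - s.r0112) * (3 * u ^ 2 * v - v ^ 3))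
      (b₄ := -(s.r1213 / 2) * (u ^ 4 - 6 * u ^ 2 * v ^ 2 + v ^ 4)
        + (s.r1212 - s.r1313) * (u ^ 3 * v - u * v ^ 3))
      fun t => by
        have e := hs.ricci_sq (u * t) (v * t)
        simp only [ricci, weylRe, weylIm, h1, h2, h3] at e
        convert e using 2 <;> ring).1
    linarith
  have e4 : s.r0102 + s.r0323 = 0 := by nlinarith
  have e5 : s.r0103 - s.r0223 = 0 := by nlinarith
  refine ⟨?_, ?_, ?_, ?_⟩ <;> linarith

/-- The homogeneous parts of `ricci_sq` for a principal null frame. -/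
lemma NonBirefringent.ricci_sq_homogeneous (hs : s.NonBirefringent) (h1 : s.r0202 = 0)
    (h2 : s.r0203 = 0) (h3 : s.r0303 = 0) (u v : ℝ) :
    ∃ f₂ f₃ f₄ a₂ a₃ a₄ b₂ b₃ b₄ : ℝ,
      f₂ = (s.r0101 + s.r2323) * (u ^ 2 + v ^ 2) + (s.r0212 - s.r0313) * (u ^ 2 - v ^ 2)
        + 2 * (s.r0213 + s.r0312) * (u * v) ∧
      f₃ = -((u ^ 2 + v ^ 2) * ((s.r0112 + s.r1323) * u + (s.r0113 - s.r1223) * v)) ∧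
      f₄ = (s.r1212 + s.r1313) / 4 * (u ^ 2 + v ^ 2) ^ 2 ∧
      a₂ = (s.r0101 + s.r0212 + s.r0313 - s.r2323) * (u ^ 2 - v ^ 2)
        + 6 * (s.r0213 - s.r0312) * (u * v) ∧
      a₃ = (s.r1323 - s.r0112) * (u ^ 3 - 3 * u * v ^ 2)
        - (s.r0113 + s.r1223) * (3 * u ^ 2 * v - v ^ 3) ∧
      a₄ = (s.r1212 - s.r1313) / 4 * (u ^ 4 - 6 * u ^ 2 * v ^ 2 + v ^ 4)
        + 2 * s.r1213 * (u ^ 3 * v - u * v ^ 3) ∧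
      b₂ = -3 * (s.r0213 - s.r0312) * (u ^ 2 - v ^ 2)
        + 2 * (s.r0101 + s.r0212 + s.r0313 - s.r2323) * (u * v) ∧
      b₃ = (s.r0113 + s.r1223) * (u ^ 3 - 3 * u * v ^ 2)
        + (s.r1323 - s.r0112) * (3 * u ^ 2 * v - v ^ 3) ∧
      b₄ = -(s.r1213 / 2) * (u ^ 4 - 6 * u ^ 2 * v ^ 2 + v ^ 4)
        + (s.r1212 - s.r1313) * (u ^ 3 * v - u * v ^ 3) ∧
      f₂ ^ 2 = a₂ ^ 2 + b₂ ^ 2 ∧ f₂ * f₃ = a₂ * a₃ + b₂ * b₃ ∧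
      2 * f₂ * f₄ + f₃ ^ 2 = 2 * a₂ * a₄ + a₃ ^ 2 + (2 * b₂ * b₄ + b₃ ^ 2) ∧
      f₄ ^ 2 = a₄ ^ 2 + b₄ ^ 2 := by
  obtain ⟨e1, e2, e3, e4⟩ := hs.first_order_eq_zero h1 h2 h3
  refine ⟨_, _, _, _, _, _, _, _, _, rfl, rfl, rfl, rfl, rfl, rfl, rfl, rfl, rfl, ?_⟩
  have := (sq_eq_sq_add_sq_coeffs
    (f₁ := 0)
    (f₂ := (s.r0101 + s.r2323) * (u ^ 2 + v ^ 2) + (s.r0212 - s.r0313) * (u ^ 2 - v ^ 2)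
    + 2 * (s.r0213 + s.r0312) * (u * v))
    (f₃ := -((u ^ 2 + v ^ 2) * ((s.r0112 + s.r1323) * u + (s.r0113 - s.r1223) * v)))
    (f₄ := (s.r1212 + s.r1313) / 4 * (u ^ 2 + v ^ 2) ^ 2)
    (a₁ := 0)
    (a₂ := (s.r0101 + s.r0212 + s.r0313 - s.r2323) * (u ^ 2 - v ^ 2)
    + 6 * (s.r0213 - s.r0312) * (u * v))
    (a₃ := (s.r1323 - s.r0112) * (u ^ 3 - 3 * u * v ^ 2)
    - (s.r0113 + s.r1223) * (3 * u ^ 2 * v - v ^ 3))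
    (a₄ := (s.r1212 - s.r1313) / 4 * (u ^ 4 - 6 * u ^ 2 * v ^ 2 + v ^ 4)
    + 2 * s.r1213 * (u ^ 3 * v - u * v ^ 3))
    (b₁ := 0)
    (b₂ := -3 * (s.r0213 - s.r0312) * (u ^ 2 - v ^ 2)
    + 2 * (s.r0101 + s.r0212 + s.r0313 - s.r2323) * (u * v))
    (b₃ := (s.r0113 + s.r1223) * (u ^ 3 - 3 * u * v ^ 2)
    + (s.r1323 - s.r0112) * (3 * u ^ 2 * v - v ^ 3))
    (b₄ := -(s.r1213 / 2) * (u ^ 4 - 6 * u ^ 2 * v ^ 2 + v ^ 4)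
    + (s.r1212 - s.r1313) * (u ^ 3 * v - u * v ^ 3))
    fun t => by
      have e := hs.ricci_sq (u * t) (v * t)
      simp only [ricci, weylRe, weylIm, h1, h2, h3, e1, e2, e3, e4] at e
      convert e using 2 <;> ring).2
  simpa using this

lemma NonBirefringent.second_order (hs : s.NonBirefringent) (h1 : s.r0202 = 0)
    (h2 : s.r0203 = 0) (h3 : s.r0303 = 0) :
    s.r0212 = s.r0313 ∧ s.r0213 = -s.r0312 ∧
      (s.r0101 + s.r0212) * (s.r2323 - s.r0212) = 9 * s.r0213 ^ 2 := by
  have key : ∀ u v : ℝ, ((s.r0101 + s.r2323) * (u ^ 2 + v ^ 2)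
      + (s.r0212 - s.r0313) * (u ^ 2 - v ^ 2) + 2 * (s.r0213 + s.r0312) * (u * v)) ^ 2 =
      ((s.r0101 + s.r0212 + s.r0313 - s.r2323) ^ 2 + 9 * (s.r0213 - s.r0312) ^ 2)
        * (u ^ 2 + v ^ 2) ^ 2 := by
    intro u v
    obtain ⟨_, _, _, _, _, _, _, _, _, rfl, -, -, rfl, -, -, rfl, -, -, h, -⟩ :=
      hs.ricci_sq_homogeneous h1 h2 h3 u v
    linear_combination h
  have k1 := key 1 0
  have k2 := key 0 1
  have k3 := key 1 1
  have k4 := key 1 (-1)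
  have k5 := key 1 2
  have hBC : (s.r0212 - s.r0313) ^ 2 = (s.r0213 + s.r0312) ^ 2 := by linarith
  have hmul : (s.r0212 - s.r0313) * (s.r0213 + s.r0312) = 0 := by linarith
  have hB : s.r0212 - s.r0313 = 0 ∧ s.r0213 + s.r0312 = 0 := by
    rcases mul_eq_zero.1 hmul with h | h <;> simp only [h] at hBC ⊢ <;>
      first | simpa using hBC | simpa using hBC.symm
  have hB' : s.r0313 = s.r0212 := by
    linarith [hB.1]
  have hC' : s.r0312 = -s.r0213 := by
    linarith [hB.2]
  refine ⟨hB'.symm, by linarith, ?_⟩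
  rw [hB', hC'] at k1
  linarith

end CurvComp

lemma eq_zero_of_sq_add_sq {x y : ℝ} (h : x ^ 2 + y ^ 2 = 0) : x = 0 ∧ y = 0 := by
  have hx : x ^ 2 = 0 := by linarith [sq_nonneg x, sq_nonneg y]
  have hy : y ^ 2 = 0 := by linarith [sq_nonneg x, sq_nonneg y]
  exact ⟨by simpa using hx, by simpa using hy⟩

/-- A symmetric `2 × 2` matrix without trace and determinant vanishes. -/
lemma eq_zero_of_trace_det {x y z : ℝ} (h : x + z = 0) (h' : x * z = y ^ 2) :
    x = 0 ∧ y = 0 ∧ z = 0 := by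
  obtain rfl : z = -x := by linarith
  obtain ⟨hx, hy⟩ := eq_zero_of_sq_add_sq (x := x) (y := y) (by linarith)
  exact ⟨hx, hy, by simp [hx]⟩

namespace CurvComp

variable {s : CurvComp}

lemma NonBirefringent.gram_det_ne_zero_of_nullForm (hs : s.NonBirefringent) (x : ℝ) (y : ℝ)
    (hτ : 2 * x + y ^ 2 ≠ 0) : (s.gram ![1, x, y, 0] 0).det ≠ 0 :=
  hs.gram_det_ne_zero (by simp) (by simpa [nullForm] using hτ)

/-- The components of weight zero determine the curvature if the Ricci tensor is isotropic. -/
lemma NonBirefringent.isConstCurv_of_ricci_eq_zero (hs : s.NonBirefringent) (h1 : s.r0202 = 0)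
    (h2 : s.r0203 = 0) (h3 : s.r0303 = 0) (hA : s.r0101 + s.r2323 = 0) : s.IsConstCurv := by
  obtain ⟨e1, e2, e3, e4⟩ := hs.first_order_eq_zero h1 h2 h3
  obtain ⟨hB, hC, hL⟩ := hs.second_order h1 h2 h3
  have h4 : s.r2323 = -s.r0101 := by linarith
  have hsq : (s.r0101 + s.r0212) ^ 2 + (3 * s.r0213) ^ 2 = 0 := by
    rw [h4] at hL
    linarith
  obtain ⟨hL1, hk'⟩ := eq_zero_of_sq_add_sq hsq
  replace hk' : s.r0213 = 0 := by linarith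
  have hk : s.r0312 = 0 := by linarith
  replace hL1 : s.r0101 = -s.r0313 := by linarith
  obtain ⟨e5, e6, e7⟩ : s.r0112 + s.r1323 = 0 ∧ s.r0113 - s.r1223 = 0 ∧
      (s.r1323 - s.r0112) ^ 2 + (s.r0113 + s.r1223) ^ 2 = 0 := by
    have key : ∀ u v : ℝ, (u ^ 2 + v ^ 2) ^ 2 *
        ((s.r0112 + s.r1323) * u + (s.r0113 - s.r1223) * v) ^ 2 = (u ^ 2 + v ^ 2) ^ 2 *
        (((s.r1323 - s.r0112) ^ 2 + (s.r0113 + s.r1223) ^ 2) * (u ^ 2 + v ^ 2)) := by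
      intro u v
      obtain ⟨f₂, f₃, _, a₂, a₃, _, b₂, b₃, _, h5, rfl, -, h6, rfl, -, h7, rfl, -, -, -, h, -⟩ :=
        hs.ricci_sq_homogeneous h1 h2 h3 u v
      have h5' : f₂ = 0 := by rw [h5, h4, hB, hC, hk]; ring
      have h6' : a₂ = 0 := by rw [h6, h4, hB, hC, hk, hL1]; ring
      have h7' : b₂ = 0 := by rw [h7, h4, hB, hC, hk, hL1]; ring
      rw [h5', h6', h7'] at h
      linear_combination h
    apply eq_zero_of_linear_sq
    intro u v
    by_cases huv : u ^ 2 + v ^ 2 = 0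
    · obtain ⟨rfl, rfl⟩ := eq_zero_of_sq_add_sq huv
      simp
    · exact mul_left_cancel₀ (pow_ne_zero 2 huv) (key u v)
  obtain ⟨e8, e9⟩ := eq_zero_of_sq_add_sq e7
  have n1 : s.r0112 = 0 := by linarith
  have n2 : s.r1323 = 0 := by linarith
  have n3 : s.r0113 = 0 := by linarith
  have n4 : s.r1223 = 0 := by linarith
  have hw : s.r1212 * s.r1313 = s.r1213 ^ 2 := by
    obtain ⟨_, _, _, _, _, _, _, _, _, -, -, rfl, -, -, rfl, -, -, rfl, -, -, -, h⟩ :=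
      hs.ricci_sq_homogeneous h1 h2 h3 1 0
    linarith
  have hw0 : s.r1212 + s.r1313 = 0 := by
    by_contra hw0
    obtain ⟨τ, hτ, hdet⟩ : ∃ τ : ℝ, τ ≠ 0 ∧
        s.r0313 * (2 * s.r0313 + τ * (s.r1212 + s.r1313)) = 0 := by
      by_cases hL0 : s.r0313 = 0
      · exact ⟨1, one_ne_zero, by simp [hL0]⟩
      · refine ⟨-(2 * s.r0313) / (s.r1212 + s.r1313), div_ne_zero (by simpa using hL0) hw0, ?_⟩
        field_simp
        ring
    refine hs.gram_det_ne_zero_of_nullForm τ 0 (by simpa using hτ) ?_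
    rw [gram_zero_det]
    simp [form, onBivectors, wedge, h1, h2, h3, e1, e2, e3, e4, hB, hk', hk, n1, n2, n3, n4, h4, hL1]
    right
    linear_combination 2 * τ ^ 2 * hdet + τ ^ 4 * hw
  obtain ⟨m2, m1, m3⟩ := eq_zero_of_trace_det hw0 hw
  refine ⟨s.r0313, fun a b c d => ?_⟩
  simp only [form, onBivectors, wedge, nullPolar, h1, h2, h3, e1, e2, e3, e4, hB, hk', hk, n1, n2,
    n3, n4, h4, hL1, m1, m2, m3]
  ring

lemma NonBirefringent.ricci_eq_zero_of_normalised (hs : s.NonBirefringent) (h1 : s.r0202 = 0)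
    (h2 : s.r0203 = 0) (h3 : s.r0303 = 0) (hp : s.r0112 + s.r1323 = 0)
    (hq : s.r0113 - s.r1223 = 0) : s.r0101 + s.r2323 = 0 := by
  by_contra hA
  obtain ⟨e1, e2, e3, e4⟩ := hs.first_order_eq_zero h1 h2 h3
  obtain ⟨hB, hC, hL⟩ := hs.second_order h1 h2 h3
  obtain ⟨_, _, _, _, _, _, _, _, _, rfl, rfl, rfl, rfl, rfl, rfl, rfl, rfl, rfl, -, k1, k2, k3⟩ :=
    hs.ricci_sq_homogeneous h1 h2 h3 1 0
  obtain ⟨_, _, _, _, _, _, _, _, _, rfl, rfl, rfl, rfl, rfl, rfl, rfl, rfl, rfl, -, k4, k5, -⟩ :=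
    hs.ricci_sq_homogeneous h1 h2 h3 0 1
  have hPQ : (s.r0101 + s.r0212 + s.r0313 - s.r2323) ^ 2 + 9 * (s.r0213 - s.r0312) ^ 2
      = (s.r0101 + s.r2323) ^ 2 := by
    rw [hC, ← hB]
    rw [hC] at hL
    linarith
  have hsq : (s.r0101 + s.r2323) ^ 2 *
      ((s.r1323 - s.r0112) ^ 2 + (s.r0113 + s.r1223) ^ 2) = 0 := by
    have k6 : (s.r0101 + s.r0212 + s.r0313 - s.r2323) * (s.r1323 - s.r0112)
        - 3 * (s.r0213 - s.r0312) * (s.r0113 + s.r1223) = 0 := by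
      rw [hp, hq] at k1
      linarith
    have k7 : (s.r0101 + s.r0212 + s.r0313 - s.r2323) * (s.r0113 + s.r1223)
        + 3 * (s.r0213 - s.r0312) * (s.r1323 - s.r0112) = 0 := by
      rw [hp, hq] at k4
      linarith
    rw [← hPQ]
    linear_combination ((s.r0101 + s.r0212 + s.r0313 - s.r2323) * (s.r1323 - s.r0112)
        - 3 * (s.r0213 - s.r0312) * (s.r0113 + s.r1223)) * k6
      + ((s.r0101 + s.r0212 + s.r0313 - s.r2323) * (s.r0113 + s.r1223)
        + 3 * (s.r0213 - s.r0312) * (s.r1323 - s.r0112)) * k7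
  have hsq' := (mul_eq_zero.1 hsq).resolve_left (pow_ne_zero 2 hA)
  obtain ⟨e8, e9⟩ := eq_zero_of_sq_add_sq hsq'
  have n1 : s.r0112 = 0 := by linarith
  have n2 : s.r1323 = 0 := by linarith
  have n3 : s.r0113 = 0 := by linarith
  have n4 : s.r1223 = 0 := by linarith
  rw [n1, n2, n3, n4] at k2 k5
  have hw : s.r1212 * s.r1313 = s.r1213 ^ 2 := by linarith
  have hw0 : s.r1212 + s.r1313 = 0 := by
    have : (s.r0101 + s.r2323) * (s.r1212 + s.r1313) = 0 := by linarith
    exact (mul_eq_zero.1 this).resolve_left hA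
  obtain ⟨m2, m1, m3⟩ := eq_zero_of_trace_det hw0 hw
  have hk : s.r0312 = -s.r0213 := by linarith
  by_cases h0 : s.r0101 = 0
  · refine hs.gram_det_ne_zero_of_nullForm 1 0 (by simp) ?_
    rw [gram_zero_det]
    simp [form, onBivectors, wedge, h0, e1, e2, n1, n3]
  · refine hs.gram_det_ne_zero_of_nullForm (s.r2323 / (2 * s.r0101)) 1 ?_ ?_
    · intro h
      field_simp at h
      exact hA (by linarith)
    · have hτ : 2 * (s.r2323 / (2 * s.r0101)) * s.r0101 = s.r2323 := by field_simp
      rw [gram_zero_det]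
      generalize s.r2323 / (2 * s.r0101) = τ at *
      simp [form, onBivectors, wedge, h1, h2, h3, e1, e2, e3, e4, ← hB, hk, n1, n2, n3, n4, m1, m2, m3]
      rw [← hτ] at hL ⊢
      linear_combination (2 * τ * s.r0212) * hL

lemma NonBirefringent.isConstCurv (hs : s.NonBirefringent) : s.IsConstCurv := by
  obtain ⟨s', hs', hc, h1, h2, h3⟩ := hs.exists_principal
  refine hc ?_
  by_cases hA : s'.r0101 + s'.r2323 = 0
  · exact hs'.isConstCurv_of_ricci_eq_zero h1 h2 h3 hA
  obtain ⟨e1, e2, e3, e4⟩ := hs'.first_order_eq_zero h1 h2 h3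
  obtain ⟨hB, hC, -⟩ := hs'.second_order h1 h2 h3
  obtain ⟨t, ht, -, hT⟩ := hs'.exists_isometric_pullback
    (nullForm_nullRotFst (-(s'.r0112 + s'.r1323) / (s'.r0101 + s'.r2323))
      (-(s'.r0113 - s'.r1223) / (s'.r0101 + s'.r2323)))
  have f1 := hT ![1, 0, 0, 0] ![0, 1, 0, 0] ![1, 0, 0, 0] ![0, 1, 0, 0]
  have f2 := hT ![0, 0, 1, 0] ![0, 0, 0, 1] ![0, 0, 1, 0] ![0, 0, 0, 1]
  have f3 := hT ![1, 0, 0, 0] ![0, 0, 1, 0] ![1, 0, 0, 0] ![0, 0, 1, 0]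
  have f4 := hT ![1, 0, 0, 0] ![0, 0, 1, 0] ![1, 0, 0, 0] ![0, 0, 0, 1]
  have f5 := hT ![1, 0, 0, 0] ![0, 0, 0, 1] ![1, 0, 0, 0] ![0, 0, 0, 1]
  have f6 := hT ![1, 0, 0, 0] ![0, 1, 0, 0] ![0, 1, 0, 0] ![0, 0, 1, 0]
  have f7 := hT ![0, 1, 0, 0] ![0, 0, 0, 1] ![0, 0, 1, 0] ![0, 0, 0, 1]
  have f8 := hT ![1, 0, 0, 0] ![0, 1, 0, 0] ![0, 1, 0, 0] ![0, 0, 0, 1]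
  have f9 := hT ![0, 1, 0, 0] ![0, 0, 1, 0] ![0, 0, 1, 0] ![0, 0, 0, 1]
  simp [form, onBivectors, wedge, nullRotFst_apply, h1, h2, h3, e1, e2, e3, e4]
    at f1 f2 f3 f4 f5 f6 f7 f8 f9
  exfalso
  have := ht.ricci_eq_zero_of_normalised f3 f4 f5
    (by
      rw [f6, f7, hC, ← hB]
      field_simp
      ring)
    (by
      rw [f8, f9, hC, ← hB]
      field_simp
      ring)
  rw [f1, f2] at this
  exact hA this

/-- Non-birefringence forces non-zero constant curvature. -/
lemma NonBirefringent.exists_form_eq (hs : s.NonBirefringent) : ∃ Λ : ℝ, Λ ≠ 0 ∧ ∀ a b c d,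
    s.form a b c d = Λ * (nullPolar a c * nullPolar b d - nullPolar a d * nullPolar b c) := by
  obtain ⟨Λ, hΛ⟩ := hs.isConstCurv
  refine ⟨Λ, ?_, hΛ⟩
  rintro rfl
  refine hs.gram_det_ne_zero_of_nullForm 1 0 (by simp) ?_
  rw [gram_zero_det]
  simp [hΛ]

end CurvComp

lemma eps_sum (F : Fin 4 → Fin 4 → Fin 4 → Fin 4 → ℝ) :
    ∑ i, ∑ j, ∑ k, ∑ l, F i j k l * eps i j k l =
      F 0 1 2 3 - F 0 1 3 2 - F 0 2 1 3 + F 0 2 3 1 + F 0 3 1 2 - F 0 3 2 1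
      - F 1 0 2 3 + F 1 0 3 2 + F 1 2 0 3 - F 1 2 3 0 - F 1 3 0 2 + F 1 3 2 0
      + F 2 0 1 3 - F 2 0 3 1 - F 2 1 0 3 + F 2 1 3 0 + F 2 3 0 1 - F 2 3 1 0
      - F 3 0 1 2 + F 3 0 2 1 + F 3 1 0 2 - F 3 1 2 0 - F 3 2 0 1 + F 3 2 1 0 := by
  simp only [Fin.sum_univ_four, eps]
  norm_num
  ring

/-- The medium tensor with its lower index pair raised by the Levi-Civita symbol. -/
def raised (κ : MT) : MT := fun i j k l => (1 / 2) * ∑ r, ∑ s, κ i j r s * eps r s k l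

lemma fresnel_eq (κ : MT) (ξ : Fin 4 → ℝ) : fresnel κ ξ = (1 / 12) * ∑ b, ∑ c, ∑ a₁, ∑ a₂, ∑ a₃,
    ∑ a₄, (∑ k, raised κ a₁ a₂ b k * ξ k) * (∑ i, ∑ l, raised κ a₃ i c l * ξ i * ξ l)
      * (∑ j, κ a₄ j b c * ξ j) * eps a₁ a₂ a₃ a₄ := by
  simp only [fresnel, G0, raised, Finset.mul_sum, Finset.sum_mul, ← Fintype.sum_prod_type']
  exact Fintype.sum_equiv
    { toFun := fun (i, j, k, l, a₁, a₂, a₃, a₄, b₁, b₂, b₃, b₄, b₅, b₆) =>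
        (b₅, b₆, a₁, a₂, a₃, a₄, j, (i, l, b₃, b₄), k, b₁, b₂)
      invFun := fun (b₅, b₆, a₁, a₂, a₃, a₄, j, (i, l, b₃, b₄), k, b₁, b₂) =>
        (i, j, k, l, a₁, a₂, a₃, a₄, b₁, b₂, b₃, b₄, b₅, b₆)
      left_inv := fun _ => rfl
      right_inv := fun _ => rfl } _ _ fun _ => by
    dsimp only [Equiv.coe_fn_mk]
    ring

/-- Contraction of `raised κ` with four vectors. -/
def raisedForm (κ : MT) (a b c d : Fin 4 → ℝ) : ℝ :=
  ∑ i, ∑ j, ∑ k, ∑ l, raised κ i j k l * a i * b j * c k * d l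

lemma raised_eq_raisedForm (κ : MT) (i j k l : Fin 4) :
    raised κ i j k l =
      raisedForm κ (Pi.single i 1) (Pi.single j 1) (Pi.single k 1) (Pi.single l 1) := by
  simp [raisedForm, Pi.single_apply]

lemma raised_antisymm {κ : MT} (h : antisymMT κ) (i j k l : Fin 4) :
    raised κ i j k l = -raised κ j i k l := by
  simp only [raised, h.1 i j, neg_mul, Finset.sum_neg_distrib, mul_neg]

lemma eq_eps_raised {κ : MT} (h : adjT κ = κ) (i j r s : Fin 4) :
    κ i j r s = (1 / 2) * ∑ a, ∑ b, eps r s a b * raised κ a b i j := by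
  conv_lhs => rw [← h]
  simp only [adjT, raised, Finset.mul_sum]
  refine Finset.sum_congr rfl fun a _ => Finset.sum_congr rfl fun b _ =>
    Finset.sum_congr rfl fun c _ => Finset.sum_congr rfl fun d _ => ?_
  ring

/-- Twelve times the Levi-Civita symbol, as an integer. -/
def epsInt (i j k l : Fin 4) : ℤ :=
  ((j.val : ℤ) - i.val) * ((k.val : ℤ) - i.val) * ((l.val : ℤ) - i.val) *
    ((k.val : ℤ) - j.val) * ((l.val : ℤ) - j.val) * ((l.val : ℤ) - k.val)

lemma epsInt_epsInt : ∀ k l a b : Fin 4, ∑ r, ∑ s, epsInt r s a b * epsInt r s k l =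
    288 * ((if a = k then 1 else 0) * (if b = l then 1 else 0)
      - (if a = l then 1 else 0) * (if b = k then 1 else 0)) := by
  decide +kernel

lemma eps_eq (i j k l : Fin 4) : eps i j k l = epsInt i j k l / 12 := by
  simp [eps, epsInt]

lemma eps_eps (k l a b : Fin 4) : ∑ r, ∑ s, eps r s a b * eps r s k l =
    2 * ((if a = k then 1 else 0) * (if b = l then 1 else 0)
      - (if a = l then 1 else 0) * (if b = k then 1 else 0)) := by
  have := congrArg (fun n : ℤ => (n : ℝ)) (epsInt_epsInt k l a b)
  push_cast at this
  simp only [eps_eq, div_mul_div_comm, ← Finset.sum_div, this]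
  ring

lemma epsInt_swap : ∀ p a b c d : Fin 4, p ≠ 0 → epsInt (Equiv.swap 0 p a) (Equiv.swap 0 p b)
    (Equiv.swap 0 p c) (Equiv.swap 0 p d) = -epsInt a b c d := by
  decide +kernel

lemma eps_swap {p : Fin 4} (hp : p ≠ 0) (a b c d : Fin 4) : eps (Equiv.swap 0 p a)
    (Equiv.swap 0 p b) (Equiv.swap 0 p c) (Equiv.swap 0 p d) = -eps a b c d := by
  rw [eps_eq, eps_eq, epsInt_swap p a b c d hp]
  push_cast
  ring

lemma raised_pair_symm {κ : MT} (ha : antisymMT κ) (h : adjT κ = κ) (i j k l : Fin 4) :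
    raised κ i j k l = raised κ k l i j := by
  have e1 : raised κ i j k l =
      (1 / 4) * ∑ a, ∑ b, raised κ a b i j * ∑ r, ∑ s, eps r s a b * eps r s k l := by
    conv_lhs => rw [raised]
    simp only [fun r s => eq_eps_raised h i j r s, Finset.mul_sum, Finset.sum_mul,
      ← Fintype.sum_prod_type']
    exact Fintype.sum_equiv
      { toFun := fun (r, s, a, b) => (a, b, r, s)
        invFun := fun (a, b, r, s) => (r, s, a, b)
        left_inv := fun _ => rfl
        right_inv := fun _ => rfl } _ _ fun _ => by
      dsimp only [Equiv.coe_fn_mk]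
      ring
  rw [e1]
  simp [eps_eps, mul_sub, Finset.sum_sub_distrib, ← mul_assoc]
  rw [raised_antisymm ha l k]
  ring

lemma raised_bianchi {κ : MT} (ha : antisymMT κ) (h : adjT κ = κ) (htr : traceT κ = 0) :
    raised κ 0 1 2 3 + raised κ 0 2 3 1 + raised κ 0 3 1 2 = 0 := by
  have h1 := raised_pair_symm ha h 0 1 2 3
  have h2 := raised_pair_symm ha h 0 2 3 1
  have h3 := raised_pair_symm ha h 0 3 1 2
  have hz : ∀ i r s, κ i i r s = 0 := fun i r s => by linarith [ha.1 i i r s]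
  simp only [raised, traceT, Fin.sum_univ_four, eps] at h1 h2 h3 htr ⊢
  norm_num [hz] at h1 h2 h3 htr ⊢
  linarith [ha.1 1 0 1 0, ha.2 0 1 1 0, ha.1 2 0 2 0, ha.2 0 2 2 0, ha.1 3 0 3 0, ha.2 0 3 3 0,
    ha.1 2 1 2 1, ha.2 1 2 2 1, ha.1 1 3 1 3, ha.2 3 1 1 3, ha.1 3 2 3 2, ha.2 2 3 3 2]

lemma isBivectorForm_raisedForm {κ : MT} (ha : antisymMT κ) (h : adjT κ = κ) :
    IsBivectorForm (raisedForm κ) where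
  add_left a a' b c d := by
    simp only [raisedForm, ← Finset.sum_add_distrib, Pi.add_apply]
    refine Finset.sum_congr rfl fun i _ => Finset.sum_congr rfl fun j _ =>
      Finset.sum_congr rfl fun k _ => Finset.sum_congr rfl fun l _ => ?_
    ring
  smul_left t a b c d := by
    simp only [raisedForm, Finset.mul_sum, Pi.smul_apply, smul_eq_mul]
    refine Finset.sum_congr rfl fun i _ => Finset.sum_congr rfl fun j _ =>
      Finset.sum_congr rfl fun k _ => Finset.sum_congr rfl fun l _ => ?_
    ring
  antisymm a b c d := by
    simp only [raisedForm, ← Finset.sum_neg_distrib]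
    rw [Finset.sum_comm]
    refine Finset.sum_congr rfl fun i _ => Finset.sum_congr rfl fun j _ =>
      Finset.sum_congr rfl fun k _ => Finset.sum_congr rfl fun l _ => ?_
    rw [raised_antisymm ha]
    ring
  pair_symm a b c d := by
    simp only [raisedForm, ← Fintype.sum_prod_type']
    exact Fintype.sum_equiv
      { toFun := fun (i, j, k, l) => (k, l, i, j)
        invFun := fun (k, l, i, j) => (i, j, k, l)
        left_inv := fun _ => rfl
        right_inv := fun _ => rfl } _ _ fun (i, j, k, l) => by
      dsimp only [Equiv.coe_fn_mk]
      rw [raised_pair_symm ha h]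
      ring

/-- A skewon-free medium tensor without trace is an algebraic curvature tensor. -/
lemma exists_raisedForm_eq {κ : MT} (ha : antisymMT κ) (h : adjT κ = κ) (htr : traceT κ = 0) :
    ∃ s : CurvComp, ∀ a b c d, raisedForm κ a b c d = s.form a b c d := by
  apply (isBivectorForm_raisedForm ha h).exists_comp
  simpa only [← raised_eq_raisedForm] using raised_bianchi ha h htr

/-- The Fresnel polynomial of the medium with raised tensor `s.form`. -/
def CurvComp.fresnelPoly (s : CurvComp) (ξ : Fin 4 → ℝ) : ℝ :=
  (1 / 12) * ∑ b, ∑ c, ∑ a₁, ∑ a₂, ∑ a₃, ∑ a₄,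
    s.form (Pi.single a₁ 1) (Pi.single a₂ 1) (Pi.single b 1) ξ
      * s.form (Pi.single a₃ 1) ξ (Pi.single c 1) ξ
      * ((1 / 2) * ∑ d, ∑ e, eps b c d e
        * s.form (Pi.single d 1) (Pi.single e 1) (Pi.single a₄ 1) ξ) * eps a₁ a₂ a₃ a₄

lemma fresnel_eq_fresnelPoly {κ : MT} (h : adjT κ = κ) {s : CurvComp}
    (hs : ∀ a b c d, raisedForm κ a b c d = s.form a b c d) (ξ : Fin 4 → ℝ) :
    fresnel κ ξ = s.fresnelPoly ξ := by
  have e1 : ∀ i j k, ∑ l, raised κ i j k l * ξ l =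
      s.form (Pi.single i 1) (Pi.single j 1) (Pi.single k 1) ξ := by
    intro i j k
    rw [← hs, raisedForm]
    simp [Pi.single_apply]
  have e2 : ∀ i k, ∑ j, ∑ l, raised κ i j k l * ξ j * ξ l =
      s.form (Pi.single i 1) ξ (Pi.single k 1) ξ := by
    intro i k
    rw [← hs, raisedForm]
    simp [Pi.single_apply]
  have e3 : ∀ i b c, ∑ j, κ i j b c * ξ j = (1 / 2) * ∑ d, ∑ e, eps b c d e
      * s.form (Pi.single d 1) (Pi.single e 1) (Pi.single i 1) ξ := by
    intro i b c
    simp only [eq_eps_raised h, ← e1, Finset.mul_sum, Finset.sum_mul]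
    rw [Finset.sum_comm]
    refine Finset.sum_congr rfl fun d _ => ?_
    rw [Finset.sum_comm]
    refine Finset.sum_congr rfl fun e _ => Finset.sum_congr rfl fun j _ => ?_
    ring
  rw [fresnel_eq, CurvComp.fresnelPoly]
  simp only [e1, e2, e3]

namespace CurvComp

lemma half_sum_eps_form (s : CurvComp) (ξ : Fin 4 → ℝ) (a b c : Fin 4) :
    (1 / 2) * ∑ d, ∑ e, eps b c d e
        * s.form (Pi.single d 1) (Pi.single e 1) (Pi.single a 1) ξ =
      eps b c 0 1 * s.form (Pi.single 0 1) (Pi.single 1 1) (Pi.single a 1) ξ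
      + eps b c 0 2 * s.form (Pi.single 0 1) (Pi.single 2 1) (Pi.single a 1) ξ
      + eps b c 0 3 * s.form (Pi.single 0 1) (Pi.single 3 1) (Pi.single a 1) ξ
      + eps b c 1 2 * s.form (Pi.single 1 1) (Pi.single 2 1) (Pi.single a 1) ξ
      + eps b c 1 3 * s.form (Pi.single 1 1) (Pi.single 3 1) (Pi.single a 1) ξ
      + eps b c 2 3 * s.form (Pi.single 2 1) (Pi.single 3 1) (Pi.single a 1) ξ := by
  have h : ∀ d e, eps b c e d * s.form (Pi.single e 1) (Pi.single d 1) (Pi.single a 1) ξ =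
      eps b c d e * s.form (Pi.single d 1) (Pi.single e 1) (Pi.single a 1) ξ := by
    intro d e
    rw [s.isBivectorForm_form.antisymm, show eps b c e d = -eps b c d e by rw [eps, eps]; ring]
    ring
  have h0 : ∀ d, eps b c d d = 0 := fun d => by rw [eps]; ring
  simp only [Fin.sum_univ_four, h0, h 0 1, h 0 2, h 0 3, h 1 2, h 1 3, h 2 3]
  ring

lemma form_antisymm_right (s : CurvComp) (a b c d : Fin 4 → ℝ) :
    s.form a b c d = -s.form a b d c := by
  simp only [form, onBivectors, wedge]
  ring

lemma sum_mul_form_eq_zero (s : CurvComp) (a b ξ : Fin 4 → ℝ) :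
    ∑ c, ξ c * s.form a b (Pi.single c 1) ξ = 0 := by
  have h := s.form_self_right a b ξ
  rw [form_sum_right] at h
  simpa only [s.form_antisymm_right a b ξ, mul_neg, Finset.sum_neg_distrib, neg_eq_zero] using h

lemma sq_mul_fresnelPoly (s : CurvComp) (ξ : Fin 4 → ℝ) (h0 : ξ 0 ≠ 0) :
    ξ 0 ^ 2 * s.fresnelPoly ξ = (s.gram ξ 0).det := by
  obtain ⟨P, hP⟩ : ∃ P : Fin 4 → Fin 4 → Fin 4 → ℝ, ∀ a b c,
    s.form (Pi.single a 1) (Pi.single b 1) (Pi.single c 1) ξ = P a b c := ⟨_, fun _ _ _ => rfl⟩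
  obtain ⟨M, hM⟩ : ∃ M : Fin 4 → Fin 4 → ℝ, ∀ a c,
    s.form (Pi.single a 1) ξ (Pi.single c 1) ξ = M a c := ⟨_, fun _ _ => rfl⟩
  have hanti : ∀ a b c, P a b c = -P b a c := fun a b c => by
    rw [← hP, ← hP, s.isBivectorForm_form.antisymm]
  obtain ⟨H, hH⟩ : ∃ H : Fin 4 → Fin 4 → Fin 4 → ℝ, ∀ a b c,
    (1 / 2) * ∑ d, ∑ e, eps b c d e * P d e a = H b c a := ⟨_, fun _ _ _ => rfl⟩
  have half := s.half_sum_eps_form ξ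
  simp only [hP, hH] at half
  have h00 : ∀ b a, H b b a = 0 := fun b a => by rw [half]; simp [eps]
  have h01 : ∀ a, H 0 1 a = P 2 3 a := fun a => by rw [half]; norm_num [eps]
  have h02 : ∀ a, H 0 2 a = -P 1 3 a := fun a => by rw [half]; norm_num [eps]
  have h03 : ∀ a, H 0 3 a = P 1 2 a := fun a => by rw [half]; norm_num [eps]
  have h12 : ∀ a, H 1 2 a = P 0 3 a := fun a => by rw [half]; norm_num [eps]
  have h13 : ∀ a, H 1 3 a = -P 0 2 a := fun a => by rw [half]; norm_num [eps]
  have h23 : ∀ a, H 2 3 a = P 0 1 a := fun a => by rw [half]; norm_num [eps]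
  have h10 : ∀ a, H 1 0 a = -P 2 3 a := fun a => by rw [half]; norm_num [eps]
  have h20 : ∀ a, H 2 0 a = P 1 3 a := fun a => by rw [half]; norm_num [eps]
  have h30 : ∀ a, H 3 0 a = -P 1 2 a := fun a => by rw [half]; norm_num [eps]
  have h21 : ∀ a, H 2 1 a = -P 0 3 a := fun a => by rw [half]; norm_num [eps]
  have h31 : ∀ a, H 3 1 a = P 0 2 a := fun a => by rw [half]; norm_num [eps]
  have h32 : ∀ a, H 3 2 a = -P 0 1 a := fun a => by rw [half]; norm_num [eps]
  clear half
  simp only [fresnelPoly, hP, hM, hH]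
  rw [Finset.sum_congr rfl fun b _ => Finset.sum_congr rfl fun c _ => eps_sum _]
  simp only [Fin.sum_univ_four, h00, h01, h02, h03, h12, h13, h23, h10, h20, h30, h21, h31, h32,
    hanti 1 0, hanti 2 0, hanti 3 0, hanti 2 1, hanti 3 1, hanti 3 2]
  clear h00 h01 h02 h03 h12 h13 h23 h10 h20 h30 h21 h31 h32 hH H
  have hsum : ∀ a c, M a c = ∑ b, ξ b * P a b c := fun a c => by
    rw [← hM, s.form_sum_snd]
    simp only [hP]
  have hself : ∀ a b, ∑ c, ξ c * P a b c = 0 := fun a b => by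
    simp only [← hP, s.sum_mul_form_eq_zero]
  have hMself : ∀ a, ∑ c, ξ c * M a c = 0 := fun a => by
    simp only [← hM, s.sum_mul_form_eq_zero]
  have hMsymm : ∀ a c, M a c = M c a := fun a c => by rw [← hM, ← hM, s.form_pair_symm]
  have hgram : ∀ a c, s.form ξ (Pi.single a 1) ξ (Pi.single c 1) = M a c := fun a c => by
    rw [← hM, s.isBivectorForm_form.antisymm, s.form_antisymm_right, neg_neg]
  have hb : P 1 2 3 = P 1 3 2 - P 2 3 1 := by
    have h := s.form_bianchi ξ (Pi.single 1 1) (Pi.single 2 1) (Pi.single 3 1)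
    rw [s.form_pair_symm, s.form_antisymm_right, hP, s.form_pair_symm, s.form_antisymm_right, hP,
      s.form_pair_symm, s.form_antisymm_right, hP, hanti 3 1] at h
    linarith
  simp only [Fin.sum_univ_four] at hsum hself hMself
  have hPself : ∀ a c, P a a c = 0 := fun a c => by linarith [hanti a a c]
  obtain ⟨N, hN⟩ : ∃ N : Fin 4 → Fin 4 → ℝ, ∀ a c, M a c = ξ 0 * N a c :=
    ⟨fun a c => M a c / ξ 0, fun a c => by field_simp⟩
  obtain ⟨t, ht⟩ : ∃ t : Fin 4 → ℝ, ∀ i, ξ i = ξ 0 * t i :=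
    ⟨fun i => ξ i / ξ 0, fun i => by field_simp⟩
  have hP0 : ∀ i c, P 0 i c = t 1 * P i 1 c + t 2 * P i 2 c + t 3 * P i 3 c - N i c :=
    fun i c => by
    apply mul_left_cancel₀ h0
    linear_combination hsum i c - hN i c + ξ 0 * hanti 0 i c + ht 1 * P i 1 c + ht 2 * P i 2 c
      + ht 3 * P i 3 c
  have hPlast : ∀ a b, P a b 0 = -(t 1 * P a b 1 + t 2 * P a b 2 + t 3 * P a b 3) :=
    fun a b => by
    apply mul_left_cancel₀ h0
    linear_combination hself a b - ht 1 * P a b 1 - ht 2 * P a b 2 - ht 3 * P a b 3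
  have hN0 : ∀ a, N a 0 = -(t 1 * N a 1 + t 2 * N a 2 + t 3 * N a 3) := fun a => by
    apply mul_left_cancel₀ (mul_ne_zero h0 h0)
    simp only [hN, ht 1, ht 2, ht 3] at hMself
    linear_combination hMself a
  have hNsymm : ∀ a c, N a c = N c a := fun a c => by
    apply mul_left_cancel₀ h0
    rw [← hN, ← hN, hMsymm]
  rw [Matrix.det_fin_three]
  simp only [gram, hgram, hN, Fin.succAbove]
  simp [hNsymm 0, hNsymm 2 1, hNsymm 3 1, hNsymm 3 2, hPlast, hP0, hN0, hPself, hanti 2 1,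
    hanti 3 1, hanti 3 2, hb]
  ring

lemma fresnelPoly_of_swap {s s' : CurvComp} {p : Fin 4} (hp : p ≠ 0) {ξ ξ' : Fin 4 → ℝ}
    (h1 : ∀ a b c, s'.form (Pi.single a 1) (Pi.single b 1) (Pi.single c 1) ξ' =
      s.form (Pi.single (Equiv.swap 0 p a) 1) (Pi.single (Equiv.swap 0 p b) 1)
        (Pi.single (Equiv.swap 0 p c) 1) ξ)
    (h2 : ∀ a c, s'.form (Pi.single a 1) ξ' (Pi.single c 1) ξ' =
      s.form (Pi.single (Equiv.swap 0 p a) 1) ξ (Pi.single (Equiv.swap 0 p c) 1) ξ) :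
    s'.fresnelPoly ξ' = s.fresnelPoly ξ := by
  have h3 : ∀ b c a, (1 / 2) * ∑ d, ∑ e, eps b c d e
        * s'.form (Pi.single d 1) (Pi.single e 1) (Pi.single a 1) ξ' =
      -((1 / 2) * ∑ d, ∑ e, eps (Equiv.swap 0 p b) (Equiv.swap 0 p c) d e
        * s.form (Pi.single d 1) (Pi.single e 1) (Pi.single (Equiv.swap 0 p a) 1) ξ) := by
    intro b c a
    rw [← mul_neg, ← Finset.sum_neg_distrib]
    refine congrArg _ (Fintype.sum_equiv (Equiv.swap 0 p) _ _ fun d => ?_)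
    rw [← Finset.sum_neg_distrib]
    refine Fintype.sum_equiv (Equiv.swap 0 p) _ _ fun e => ?_
    rw [h1, eps_swap hp, neg_mul, neg_neg]
  rw [fresnelPoly, fresnelPoly]
  refine congrArg _ (Fintype.sum_equiv (Equiv.swap 0 p) _ _ fun b =>
    Fintype.sum_equiv (Equiv.swap 0 p) _ _ fun c => Fintype.sum_equiv (Equiv.swap 0 p) _ _ fun a₁ =>
    Fintype.sum_equiv (Equiv.swap 0 p) _ _ fun a₂ => Fintype.sum_equiv (Equiv.swap 0 p) _ _ fun a₃ =>
    Fintype.sum_equiv (Equiv.swap 0 p) _ _ fun a₄ => ?_)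
  rw [h1, h2, h3, eps_swap hp]
  ring

/-- The Fresnel polynomial vanishes exactly on the characteristic covectors. -/
lemma fresnelPoly_eq_zero_iff (s : CurvComp) (ξ : Fin 4 → ℝ) :
    s.fresnelPoly ξ = 0 ↔ s.IsCharacteristic ξ := by
  have main : ∀ (s : CurvComp) (ξ : Fin 4 → ℝ), ξ 0 ≠ 0 →
      (s.fresnelPoly ξ = 0 ↔ s.IsCharacteristic ξ) := fun s ξ h0 => by
    rw [s.isCharacteristic_iff h0, ← s.sq_mul_fresnelPoly ξ h0, mul_eq_zero_iff_left (by positivity)]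
  by_cases hξ : ξ = 0
  · subst hξ
    refine iff_of_true ?_ ⟨Pi.single 0 1, fun c => ?_, fun ζ => ?_⟩
    · have h0 : ∀ a b c, s.form a b c 0 = 0 := fun a b c => by simp [form, onBivectors, wedge]
      simp [fresnelPoly, h0]
    · rw [smul_zero]
      simp
    · simp [form, onBivectors, wedge]
  obtain ⟨p, hp⟩ : ∃ p, ξ p ≠ 0 := by
    by_contra! h
    exact hξ (funext h)
  by_cases hp0 : p = 0
  · exact main s ξ (hp0 ▸ hp)
  have hσ : ∀ a : Fin 4, (LinearEquiv.funCongrLeft ℝ ℝ (Equiv.swap 0 p)) (Pi.single a 1) =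
      Pi.single (Equiv.swap 0 p a) 1 := fun a => by
    funext m
    simp [LinearEquiv.funCongrLeft_apply, Pi.single_apply, LinearMap.funLeft_apply,
      Equiv.swap_apply_eq_iff]
  have hξσ : (LinearEquiv.funCongrLeft ℝ ℝ (Equiv.swap 0 p)) (ξ ∘ Equiv.swap 0 p) = ξ := by
    funext m
    simp [LinearEquiv.funCongrLeft_apply, LinearMap.funLeft_apply]
  obtain ⟨s', h1, h2⟩ := s.exists_pullback (LinearEquiv.funCongrLeft ℝ ℝ (Equiv.swap 0 p))
  have h := main s' (ξ ∘ Equiv.swap 0 p) (by simpa using hp)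
  rwa [h2, hξσ, fresnelPoly_of_swap (s := s) (ξ := ξ) hp0 (fun a b c => by rw [h1, hσ, hσ, hσ, hξσ])
    (fun a c => by rw [h1, hσ, hσ, hξσ])] at h

end CurvComp

lemma det_eq_sum_eps (A : Matrix (Fin 4) (Fin 4) ℝ) : A.det =
    ∑ i, ∑ j, ∑ k, ∑ l, A i 0 * A j 1 * A k 2 * A l 3 * eps i j k l := by
  rw [eps_sum fun i j k l => A i 0 * A j 1 * A k 2 * A l 3, Matrix.det_succ_row_zero]
  simp [Fin.sum_univ_four, Matrix.det_fin_three, Fin.succAbove]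
  ring

/-- The Levi-Civita symbol is a relative tensor. -/
lemma sum_mul_eps (h : Matrix (Fin 4) (Fin 4) ℝ) (a b c d : Fin 4) :
    ∑ i, ∑ j, ∑ k, ∑ l, h i a * h j b * h k c * h l d * eps i j k l = h.det * eps a b c d := by
  have h1 := det_eq_sum_eps (h.submatrix id ![a, b, c, d])
  have h2 := det_eq_sum_eps ((1 : Matrix (Fin 4) (Fin 4) ℝ).submatrix id ![a, b, c, d])
  have h3 : h.submatrix id ![a, b, c, d] =
      h * (1 : Matrix (Fin 4) (Fin 4) ℝ).submatrix id ![a, b, c, d] := by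
    ext i j
    simp [Matrix.mul_apply, Matrix.one_apply]
  rw [h3, Matrix.det_mul, h2, ← h3] at h1
  have h4 : ∑ i, ∑ j, ∑ k, ∑ l, (1 : Matrix (Fin 4) (Fin 4) ℝ) i a
      * (1 : Matrix (Fin 4) (Fin 4) ℝ) j b * (1 : Matrix (Fin 4) (Fin 4) ℝ) k c
      * (1 : Matrix (Fin 4) (Fin 4) ℝ) l d * eps i j k l = eps a b c d := by
    simp only [Matrix.one_apply, mul_assoc, ← Finset.mul_sum]
    simp
  rw [← h4]
  exact h1.symm

lemma exists_sign_of_prod_neg {x : Fin 4 → ℝ} (hx : ∏ i, x i < 0) :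
    ∃ σ : ℝ, σ ^ 2 = 1 ∧ ∃ p, σ * x p < 0 ∧ ∀ i, i ≠ p → 0 < σ * x i := by
  rw [Fin.prod_univ_four, mul_assoc] at hx
  simp only [mul_neg_iff, mul_pos_iff] at hx
  rcases hx with ⟨⟨h0, h1⟩ | ⟨h0, h1⟩, ⟨h2, h3⟩ | ⟨h2, h3⟩⟩ | ⟨⟨h0, h1⟩ | ⟨h0, h1⟩, ⟨h2, h3⟩ | ⟨h2, h3⟩⟩
  · exact ⟨1, by norm_num, 3, by simpa, fun i hi => by fin_cases i <;> simp_all⟩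
  · exact ⟨1, by norm_num, 2, by simpa, fun i hi => by fin_cases i <;> simp_all⟩
  · exact ⟨-1, by norm_num, 2, by simpa, fun i hi => by fin_cases i <;> simp_all⟩
  · exact ⟨-1, by norm_num, 3, by simpa, fun i hi => by fin_cases i <;> simp_all⟩
  · exact ⟨1, by norm_num, 1, by simpa, fun i hi => by fin_cases i <;> simp_all⟩
  · exact ⟨-1, by norm_num, 0, by simpa, fun i hi => by fin_cases i <;> simp_all⟩
  · exact ⟨1, by norm_num, 0, by simpa, fun i hi => by fin_cases i <;> simp_all⟩
  · exact ⟨-1, by norm_num, 1, by simpa, fun i hi => by fin_cases i <;> simp_all⟩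

/-- A symmetric matrix of negative determinant admits a null frame, up to sign. -/
lemma exists_nullFrame {h : Matrix (Fin 4) (Fin 4) ℝ} (hs : h.IsSymm) (hd : h.det < 0) :
    ∃ σ : ℝ, σ ^ 2 = 1 ∧ ∃ T : (Fin 4 → ℝ) ≃ₗ[ℝ] (Fin 4 → ℝ), ∀ ξ η,
      h.toBilin' (T ξ) (T η) = σ * nullPolar ξ η := by
  have hH : h.IsHermitian := by
    rw [Matrix.IsHermitian, Matrix.conjTranspose_eq_transpose_of_trivial, hs.eq]
  have hprod : ∏ i, hH.eigenvalues i < 0 := by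
    have := hH.det_eq_prod_eigenvalues
    simpa [this] using hd
  obtain ⟨σ, hσ, p, hp, hpos⟩ := exists_sign_of_prod_neg hprod
  refine ⟨σ, hσ, ?_⟩
  let u : Fin 4 → Fin 4 → ℝ := fun i => (hH.eigenvectorBasis i).ofLp
  have hu : ∀ i j, h.toBilin' (u i) (u j) = if i = j then hH.eigenvalues i else 0 := fun i j => by
    rw [Matrix.toBilin'_apply', hH.mulVec_eigenvectorBasis]
    have := hH.eigenvectorBasis.orthonormal
    rw [orthonormal_iff_ite] at this
    have := this j i
    rw [EuclideanSpace.inner_eq_star_dotProduct] at this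
    simp [u, dotProduct_smul] at this ⊢
    rw [this]
    simp [eq_comm]
    aesop
  let f : Fin 4 → Fin 4 → ℝ := fun i =>
    (√|hH.eigenvalues (Equiv.swap 0 p i)|)⁻¹ • u (Equiv.swap 0 p i)
  have hf : ∀ i j, h.toBilin' (f i) (f j) = if i = j then (if i = 0 then -σ else σ) else 0 := by
    intro i j
    simp only [f, map_smul, LinearMap.smul_apply, hu, smul_eq_mul]
    have key : ∀ x : ℝ, (√|x|)⁻¹ * ((√|x|)⁻¹ * x) = x / |x| := fun x => by
      rw [← mul_assoc, ← mul_inv, Real.mul_self_sqrt (abs_nonneg x), inv_mul_eq_div]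
    have hσ1 : σ = 1 ∨ σ = -1 := by simpa using hσ
    by_cases hij : i = j
    · subst hij
      rw [if_pos rfl, if_pos rfl, key]
      by_cases hi : i = 0
      · rw [if_pos hi, hi, Equiv.swap_apply_left]
        rcases hσ1 with rfl | rfl
        · have hx : hH.eigenvalues p < 0 := by linarith
          rw [abs_of_neg hx, div_neg, div_self hx.ne]
        · have hx : 0 < hH.eigenvalues p := by linarith
          rw [abs_of_pos hx, div_self hx.ne', neg_neg]
      · have hi' := hpos (Equiv.swap 0 p i) fun h => hi (by simpa [Equiv.swap_apply_eq_iff] using h)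
        rw [if_neg hi]
        rcases hσ1 with rfl | rfl
        · have hx : 0 < hH.eigenvalues (Equiv.swap 0 p i) := by linarith
          rw [abs_of_pos hx, div_self hx.ne']
        · have hx : hH.eigenvalues (Equiv.swap 0 p i) < 0 := by linarith
          rw [abs_of_neg hx, div_neg, div_self hx.ne]
    · rw [if_neg hij, if_neg (by simpa using hij)]
      simp
  let T : (Fin 4 → ℝ) →ₗ[ℝ] (Fin 4 → ℝ) :=
    Fintype.linearCombination ℝ ![f 0 + f 1, (1 / 2 : ℝ) • (f 1 - f 0), f 2, f 3]
  have hT : ∀ ξ η, h.toBilin' (T ξ) (T η) = σ * nullPolar ξ η := fun ξ η => by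
    simp [T, Fintype.linearCombination_apply, Fin.sum_univ_four, hf, nullPolar]
    ring
  have hinj : Function.Injective T := by
    rw [injective_iff_map_eq_zero]
    intro ξ hξ
    have h0 : ∀ η, nullPolar ξ η = 0 := fun η => by
      have := hT ξ η
      rw [hξ, map_zero, LinearMap.zero_apply] at this
      have hσ0 : σ ≠ 0 := by
        rintro rfl
        norm_num at hσ
      simpa [hσ0] using this.symm
    have h1 := fun i => h0 (Pi.single i 1)
    funext m
    have := h1 0; have := h1 1; have := h1 2; have := h1 3
    simp [nullPolar] at *
    fin_cases m <;> simp [*]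
  exact ⟨LinearEquiv.ofInjectiveEndo T hinj, fun ξ η => by simpa using hT ξ η⟩

lemma compT_self_of_raised {κ : MT} (ha : adjT κ = κ) {h : Matrix (Fin 4) (Fin 4) ℝ}
    (hs : h.IsSymm) {Λ : ℝ}
    (hr : ∀ i j k l, raised κ i j k l = Λ * (h i k * h j l - h i l * h j k)) :
    compT κ κ = fun i j r s => Λ ^ 2 * h.det * idT i j r s := by
  have e1 : ∀ i j r s, κ i j r s = Λ * ∑ a, ∑ b, eps r s a b * h a i * h b j := by
    intro i j r s
    have : ∑ a, ∑ b, eps r s a b * h a j * h b i = -∑ a, ∑ b, eps r s a b * h a i * h b j := by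
      rw [Finset.sum_comm]
      simp only [← Finset.sum_neg_distrib]
      refine Finset.sum_congr rfl fun a _ => Finset.sum_congr rfl fun b _ => ?_
      rw [show eps r s b a = -eps r s a b by rw [eps, eps]; ring]
      ring
    rw [eq_eps_raised ha]
    simp only [hr]
    have e : ∀ a b, eps r s a b * (Λ * (h a i * h b j - h a j * h b i)) =
      Λ * (eps r s a b * h a i * h b j) - Λ * (eps r s a b * h a j * h b i) := fun a b => by ring
    simp only [e, Finset.sum_sub_distrib, ← Finset.mul_sum, this]
    ring
  funext i j r s
  have e2 : compT κ κ i j r s = (1 / 2) * Λ ^ 2 * ∑ c, ∑ d, eps r s c d *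
      ∑ a, ∑ b, ∑ e, ∑ f, h a c * h b d * h e i * h f j * eps a b e f := by
    simp only [compT, e1, Finset.mul_sum, Finset.sum_mul, ← Fintype.sum_prod_type']
    exact Fintype.sum_equiv
      { toFun := fun (a, b, (e, f), c, d) => (c, d, a, b, e, f)
        invFun := fun (c, d, a, b, e, f) => (a, b, (e, f), c, d)
        left_inv := fun _ => rfl
        right_inv := fun _ => rfl } _ _ fun (a, b, (e, f), c, d) => by
      dsimp only [Equiv.coe_fn_mk]
      rw [hs.apply a c, hs.apply b d]
      ring
  have e3 := eps_eps i j r s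
  have e4 : ∀ c d, eps r s c d * (h.det * eps c d i j) = h.det * (eps c d r s * eps c d i j) :=
    fun c d => by
    rw [show eps r s c d = eps c d r s by rw [eps, eps]; ring]
    ring
  rw [e2]
  simp only [sum_mul_eps, e4, ← Finset.mul_sum, e3, idT]
  simp only [eq_comm (a := r), eq_comm (a := s)]
  ring

/-- Pointwise Obukhov–Hehl conjecture (Favaro–Bergamin): a skewon-free,
axion-free, non-birefringent medium tensor satisfies the closure condition
κ∘κ = −λ·Id with λ > 0. -/
theorem stmt8 (κ : MT) (hanti : antisymMT κ) (hskew : adjT κ = κ)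
    (htr : traceT κ = 0)
    (g : Matrix (Fin 4) (Fin 4) ℝ) (hg : IsLorentz g)
    (hbire : {ξ | fresnel κ ξ = 0} = nullCone g) :
    ∃ lam : ℝ, 0 < lam ∧ compT κ κ = fun i j r s => -lam * idT i j r s := by
  obtain ⟨s, hs⟩ := exists_raisedForm_eq hanti hskew htr
  have hsymm : g⁻¹.IsSymm := by rw [Matrix.IsSymm, Matrix.transpose_nonsing_inv, hg.1.eq]
  have hdet : g⁻¹.det < 0 := by
    rw [Matrix.det_nonsing_inv, Ring.inverse_eq_inv']
    exact inv_lt_zero.mpr hg.2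
  obtain ⟨σ, hσ, T, hT⟩ := exists_nullFrame hsymm hdet
  have hσ0 : σ ≠ 0 := by
    rintro rfl
    norm_num at hσ
  obtain ⟨s', hs', hchar⟩ := s.exists_pullback T
  have hnb : s'.NonBirefringent := fun ξ => by
    have h1 : fresnel κ (T ξ) = 0 ↔ g⁻¹.toBilin' (T ξ) (T ξ) = 0 := by
      rw [Matrix.toBilin'_apply]
      simpa [nullCone, mul_comm, mul_left_comm] using Set.ext_iff.mp hbire (T ξ)
    rw [hchar, ← s.fresnelPoly_eq_zero_iff, ← fresnel_eq_fresnelPoly hskew hs, h1, hT,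
      mul_eq_zero_iff_left hσ0, show nullPolar ξ ξ = nullForm ξ by rw [nullPolar, nullForm]; ring]
  obtain ⟨Λ, hΛ, hform⟩ := hnb.exists_form_eq
  have hr : ∀ i j k l, raised κ i j k l = Λ * (g⁻¹ i k * g⁻¹ j l - g⁻¹ i l * g⁻¹ j k) := by
    intro i j k l
    have key : ∀ i j, g⁻¹ i j = σ * nullPolar (T.symm (Pi.single i 1)) (T.symm (Pi.single j 1)) :=
      fun i j => by
        rw [← hT, T.apply_symm_apply, T.apply_symm_apply, Matrix.toBilin'_single]
    have h1 := hform (T.symm (Pi.single i 1)) (T.symm (Pi.single j 1)) (T.symm (Pi.single k 1))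
      (T.symm (Pi.single l 1))
    simp only [hs', T.apply_symm_apply] at h1
    rw [raised_eq_raisedForm, hs, h1]
    simp only [key]
    linear_combination (-Λ * (nullPolar (T.symm (Pi.single i 1)) (T.symm (Pi.single k 1))
      * nullPolar (T.symm (Pi.single j 1)) (T.symm (Pi.single l 1))
      - nullPolar (T.symm (Pi.single i 1)) (T.symm (Pi.single l 1))
      * nullPolar (T.symm (Pi.single j 1)) (T.symm (Pi.single k 1)))) * hσ
  refine ⟨-(Λ ^ 2 * g⁻¹.det), ?_, ?_⟩
  · have : 0 < Λ ^ 2 := by positivity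
    nlinarith
  · rw [compT_self_of_raised hskew hsymm hr, neg_neg]
end
end

section
/- (Lindell–Favaro–Bergamin decomposability theorem, algebraic form.) Let M be a real 6×6 matrix, let α, β, γ, ρ ∈ ℝ with β and γ not both zero and ρ ≠ 0, and let a, b ∈ ℝ⁶ be nonzero vectors. Assume the algebraic decomposability condition αE + β(MᵀE + EM) + γ MᵀEM = 2ρ(abᵀ + baᵀ). Then every X ∈ ℂ⁶ satisfying XᵀEX = 0, XᵀEMX = 0 and Xᵀ(MᵀEM)X = 0 (the conditions satisfied by the component vector of the complex polarization 2-form of any plane wave in the medium represented by M) also satisfies (aᵀX)(bᵀX) = 0. -/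
noncomputable section
open Matrix BigOperators

/-- The wedge-pairing matrix E = [[0, I₃],[I₃, 0]] in the index-pair basis
O = (01, 02, 03, 23, 31, 12) for 2-forms on ℝ⁴. -/
def Emat : Matrix (Fin 6) (Fin 6) ℝ :=
  !![0, 0, 0, 1, 0, 0;
     0, 0, 0, 0, 1, 0;
     0, 0, 0, 0, 0, 1;
     1, 0, 0, 0, 0, 0;
     0, 1, 0, 0, 0, 0;
     0, 0, 1, 0, 0, 0]

/-- The complex quadratic form `X ↦ Xᵀ N X` of a real matrix `N`, as a linear function of `N`. -/
def complexQuadEval {n : Type*} [Fintype n] (X : n → ℂ) : Matrix n n ℝ →ₗ[ℝ] ℂ where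
  toFun N := X ⬝ᵥ (N.map Complex.ofReal).mulVec X
  map_add' N P := by
    rw [Matrix.map_add _ Complex.ofReal_add, Matrix.add_mulVec, dotProduct_add]
  map_smul' c N := by
    have h : (c • N).map Complex.ofReal = c • N.map Complex.ofReal := by
      ext i j
      simp
    rw [h, Matrix.smul_mulVec, dotProduct_smul, RingHom.id_apply]

theorem complexQuadEval_apply {n : Type*} [Fintype n] (X : n → ℂ) (N : Matrix n n ℝ) :
    complexQuadEval X N = X ⬝ᵥ (N.map Complex.ofReal).mulVec X := rfl

theorem complexQuadEval_transpose {n : Type*} [Fintype n] (X : n → ℂ) (N : Matrix n n ℝ) :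
    complexQuadEval X Nᵀ = complexQuadEval X N := by
  rw [complexQuadEval_apply, complexQuadEval_apply, Matrix.transpose_map,
    Matrix.mulVec_transpose, dotProduct_comm, Matrix.dotProduct_mulVec]

theorem complexQuadEval_vecMulVec {n : Type*} [Fintype n] (X : n → ℂ) (a b : n → ℝ) :
    complexQuadEval X (vecMulVec a b) =
      ((fun i => (a i : ℂ)) ⬝ᵥ X) * ((fun i => (b i : ℂ)) ⬝ᵥ X) := by
  have h : (vecMulVec a b).map Complex.ofReal =
      vecMulVec (fun i => (a i : ℂ)) (fun i => (b i : ℂ)) := by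
    ext i j
    simp [vecMulVec_apply]
  rw [complexQuadEval_apply, h, Matrix.dotProduct_mulVec, Matrix.vecMul_vecMulVec, smul_dotProduct,
    smul_eq_mul, dotProduct_comm X]

theorem Emat_transpose : Ematᵀ = Emat := by
  ext i j
  fin_cases i <;> fin_cases j <;> rfl

/-- Lindell–Favaro–Bergamin decomposability theorem, algebraic form: if
αE + β(MᵀE + EM) + γMᵀEM = 2ρ(abᵀ + baᵀ) with β, γ not both zero, ρ ≠ 0 and
a, b nonzero, then every complex polarization vector X of a plane wave (i.e.
XᵀEX = XᵀEMX = Xᵀ(MᵀEM)X = 0) satisfies (aᵀX)(bᵀX) = 0. -/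
theorem stmt9 (M : Matrix (Fin 6) (Fin 6) ℝ) (α β γ ρ : ℝ) (a b : Fin 6 → ℝ)
    (hβγ : ¬(β = 0 ∧ γ = 0)) (hρ : ρ ≠ 0) (ha : a ≠ 0) (hb : b ≠ 0)
    (hdec : α • Emat + β • (Mᵀ * Emat + Emat * M) + γ • (Mᵀ * Emat * M) =
      (2 * ρ) • (Matrix.vecMulVec a b + Matrix.vecMulVec b a))
    (X : Fin 6 → ℂ)
    (h1 : X ⬝ᵥ (Emat.map Complex.ofReal).mulVec X = 0)
    (h2 : X ⬝ᵥ ((Emat * M).map Complex.ofReal).mulVec X = 0)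
    (h3 : X ⬝ᵥ ((Mᵀ * Emat * M).map Complex.ofReal).mulVec X = 0) :
    ((fun i => (a i : ℂ)) ⬝ᵥ X) * ((fun i => (b i : ℂ)) ⬝ᵥ X) = 0 := by
  rw [← complexQuadEval_apply] at h1 h2 h3
  have h2' : complexQuadEval X (Mᵀ * Emat) = 0 := by
    rw [← complexQuadEval_transpose, Matrix.transpose_mul, Matrix.transpose_transpose,
      Emat_transpose, h2]
  have h := congrArg (complexQuadEval X) hdec
  simp only [map_add, map_smul, h1, h2, h2', h3, complexQuadEval_vecMulVec, smul_zero, add_zero,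
    Complex.real_smul] at h
  have hρ' : (4 : ℂ) * ρ ≠ 0 := by simpa using hρ
  refine (mul_eq_zero.mp ?_).resolve_left hρ'
  push_cast at h
  linear_combination -h
end
end

section
/- (Riccati transformation of the algebraic decomposability condition.) Suppose κ is a medium tensor on ℝ⁴, α, β, γ, ρ ∈ ℝ with γ ≠ 0, and A, B, D are bivectors such that α·Id + β(κ + κ̄) + γ(κ̄∘κ) = ρ(Ā⊗B) + ρ(B̄⊗A), and such that D(γκ + β·Id) = (1/2)·tr(ρ D̄⊗D)·A + γ·B as bivectors. Then the medium tensor η := γ·κ − ρ(D̄⊗A) + β·Id satisfies η̄∘η = (β² − αγ)·Id. -/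
noncomputable section
open Matrix BigOperators

/-- Action of a bivector on a medium tensor: `(Dη)^{ij} = (1/2) D^{ab} η^{ij}_{ab}`. -/
def bvAct (D : BV) (η : MT) : BV := fun i j => (1 / 2) * ∑ a, ∑ b, D a b * η i j a b

/-- The `16 × 16` matrix on index pairs with rows `rs` and columns `ij` whose entries are half the
components of a medium tensor; with this normalisation composition is the matrix product. -/
def pairMatrix (κ : MT) : Matrix (Fin 4 × Fin 4) (Fin 4 × Fin 4) ℝ :=
  Matrix.of fun p q => (1 / 2) * κ q.1 q.2 p.1 p.2

/-- A bivector as a vector indexed by pairs. -/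
def pairVec (A : BV) : Fin 4 × Fin 4 → ℝ := fun p => A p.1 p.2

/-- Half the Levi-Civita symbol as a matrix on index pairs. -/
def epsMatrix : Matrix (Fin 4 × Fin 4) (Fin 4 × Fin 4) ℝ :=
  Matrix.of fun p q => (1 / 2) * eps p.1 p.2 q.1 q.2

theorem pairMatrix_injective : Function.Injective pairMatrix := by
  intro κ η h
  funext i j r s
  have := congrFun (congrFun h (r, s)) (i, j)
  simpa [pairMatrix] using this

theorem pairMatrix_compT (κ η : MT) :
    pairMatrix (compT κ η) = pairMatrix κ * pairMatrix η := by
  ext p q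
  simp only [pairMatrix, compT, Matrix.mul_apply, Matrix.of_apply, Fintype.sum_prod_type,
    Finset.mul_sum]
  refine Finset.sum_congr rfl fun a _ => Finset.sum_congr rfl fun b _ => ?_
  ring

theorem pairMatrix_adjT (κ : MT) :
    pairMatrix (adjT κ) = epsMatrix * (pairMatrix κ)ᵀ * epsMatrix := by
  ext p q
  rw [Matrix.mul_assoc]
  simp only [pairMatrix, adjT, epsMatrix, Matrix.mul_apply, Matrix.of_apply,
    Matrix.transpose_apply, Fintype.sum_prod_type, Finset.mul_sum]
  refine Finset.sum_congr rfl fun a _ => Finset.sum_congr rfl fun b _ =>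
    Finset.sum_congr rfl fun c _ => Finset.sum_congr rfl fun d _ => ?_
  ring

theorem pairMatrix_tensAB (ρ : ℝ) (A B : BV) :
    pairMatrix (tensAB ρ A B) =
      ρ • Matrix.vecMulVec (epsMatrix *ᵥ pairVec A) (pairVec B) := by
  ext p q
  simp only [pairMatrix, tensAB, epsMatrix, pairVec, Matrix.of_apply, Matrix.smul_apply,
    Matrix.vecMulVec_apply, Matrix.mulVec, dotProduct, Fintype.sum_prod_type, smul_eq_mul,
    Finset.mul_sum, Finset.sum_mul]
  refine Finset.sum_congr rfl fun a _ => Finset.sum_congr rfl fun b _ => ?_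
  ring

theorem traceT_tensAB (ρ : ℝ) (A B : BV) :
    traceT (tensAB ρ A B) = ρ * (pairVec B ⬝ᵥ epsMatrix *ᵥ pairVec A) := by
  simp only [traceT, tensAB, epsMatrix, pairVec, Matrix.of_apply,
    Matrix.mulVec, dotProduct, Fintype.sum_prod_type, Finset.mul_sum, Finset.sum_mul]
  refine Finset.sum_congr rfl fun i _ => Finset.sum_congr rfl fun j _ =>
    Finset.sum_congr rfl fun a _ => Finset.sum_congr rfl fun b _ => ?_
  ring

theorem pairVec_bvAct (D : BV) (η : MT) :
    pairVec (bvAct D η) = pairVec D ᵥ* pairMatrix η := by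
  ext p
  simp only [pairVec, bvAct, pairMatrix, Matrix.vecMul, dotProduct, Matrix.of_apply,
    Fintype.sum_prod_type, Finset.mul_sum]
  refine Finset.sum_congr rfl fun a _ => Finset.sum_congr rfl fun b _ => ?_
  ring

theorem eps_eq_epsInt (i j k l : Fin 4) : eps i j k l = (epsInt i j k l : ℝ) / 12 := by
  simp [eps, epsInt]

theorem epsInt_contract : ∀ i j r s : Fin 4,
    ∑ a, ∑ b, epsInt r s a b * epsInt a b i j =
      288 * ((if i = r then 1 else 0) * (if j = s then 1 else 0) -
        (if i = s then 1 else 0) * (if j = r then 1 else 0)) := by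
  simp only [Fin.sum_univ_four]
  decide +kernel

theorem epsMatrix_mul_self : epsMatrix * epsMatrix = pairMatrix idT := by
  ext ⟨r, s⟩ ⟨i, j⟩
  have h := congrArg (Int.cast : ℤ → ℝ) (epsInt_contract i j r s)
  push_cast at h
  have h' : (epsMatrix * epsMatrix) (r, s) (i, j) =
      (∑ a, ∑ b, (epsInt r s a b : ℝ) * epsInt a b i j) / 576 := by
    simp only [epsMatrix, eps_eq_epsInt, Matrix.mul_apply, Matrix.of_apply,
      Fintype.sum_prod_type, Finset.sum_div]
    refine Finset.sum_congr rfl fun a _ => Finset.sum_congr rfl fun b _ => ?_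
    ring
  rw [h', h]
  simp only [pairMatrix, idT, Matrix.of_apply]
  ring

theorem epsMatrix_transpose : epsMatrixᵀ = epsMatrix := by
  ext p q
  simp only [epsMatrix, Matrix.transpose_apply, Matrix.of_apply, eps]
  ring

theorem pairMatrix_idT_mul_apply (X : Matrix (Fin 4 × Fin 4) (Fin 4 × Fin 4) ℝ)
    (r s : Fin 4) (q : Fin 4 × Fin 4) :
    (pairMatrix idT * X) (r, s) q = (1 / 2) * (X (r, s) q - X (s, r) q) := by
  simp only [pairMatrix, idT, Matrix.mul_apply, Matrix.of_apply, Fintype.sum_prod_type]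
  simp [mul_sub, sub_mul, Finset.sum_sub_distrib]

theorem pairMatrix_idT_mulVec_apply (v : Fin 4 × Fin 4 → ℝ) (r s : Fin 4) :
    (pairMatrix idT *ᵥ v) (r, s) = (1 / 2) * (v (r, s) - v (s, r)) := by
  simp only [pairMatrix, idT, Matrix.mulVec, dotProduct, Matrix.of_apply, Fintype.sum_prod_type]
  simp [mul_sub, sub_mul, Finset.sum_sub_distrib]

theorem pairMatrix_idT_mul {κ : MT} (hκ : antisymMT κ) :
    pairMatrix idT * pairMatrix κ = pairMatrix κ := by
  ext ⟨r, s⟩ ⟨i, j⟩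
  rw [pairMatrix_idT_mul_apply]
  have := hκ.2 i j r s
  simp only [pairMatrix, Matrix.of_apply]
  linarith

theorem pairMatrix_idT_mul_epsMatrix : pairMatrix idT * epsMatrix = epsMatrix := by
  ext ⟨r, s⟩ ⟨i, j⟩
  rw [pairMatrix_idT_mul_apply]
  simp only [epsMatrix, Matrix.of_apply, eps]
  ring

theorem pairMatrix_idT_mulVec {A : BV} (hA : antisymBV A) :
    pairMatrix idT *ᵥ pairVec A = pairVec A := by
  ext ⟨r, s⟩
  rw [pairMatrix_idT_mulVec_apply]
  have := hA r s
  simp only [pairVec]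
  linarith

/-- The Riccati transformation for matrices: `E` is a symmetric form with `E ^ 3 = E`, and the
adjoint of `K` is `E * Kᵀ * E`. -/
theorem riccati_matrix {n R : Type*} [Fintype n] [CommRing R]
    {E P K : Matrix n n R} {a b d : n → R} {α β γ ρ c : R}
    (hE : Eᵀ = E) (hEE : E * E = P) (hPE : P * E = E) (hPK : P * K = K) (hPd : P *ᵥ d = d)
    (hc : ρ * (d ⬝ᵥ E *ᵥ d) = 2 * c)
    (h : α • P + β • (K + E * Kᵀ * E) + γ • (E * Kᵀ * E * K) =
      ρ • Matrix.vecMulVec (E *ᵥ a) b + ρ • Matrix.vecMulVec (E *ᵥ b) a)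
    (hd : d ᵥ* (γ • K + β • P) = c • a + γ • b) :
    E * (γ • K - ρ • Matrix.vecMulVec (E *ᵥ d) a + β • P)ᵀ * E *
        (γ • K - ρ • Matrix.vecMulVec (E *ᵥ d) a + β • P) = (β ^ 2 - α * γ) • P := by
  have hPt : Pᵀ = P := by rw [← hEE, Matrix.transpose_mul, hE]
  have hEP : E * P = E := by rw [← hEE, ← Matrix.mul_assoc, hEE, hPE]
  have hPP : P * P = P := by rw [← hEE, ← Matrix.mul_assoc, hEE, hPE, hEE]
  have hadj : E * (γ • K - ρ • Matrix.vecMulVec (E *ᵥ d) a + β • P)ᵀ * E =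
      γ • (E * Kᵀ * E) - ρ • Matrix.vecMulVec (E *ᵥ a) d + β • P := by
    have h1 : E * Matrix.vecMulVec a (E *ᵥ d) * E = Matrix.vecMulVec (E *ᵥ a) d := by
      rw [Matrix.mul_vecMulVec, Matrix.vecMulVec_mul, ← Matrix.mulVec_transpose, hE,
        Matrix.mulVec_mulVec, hEE, hPd]
    simp only [Matrix.transpose_add, Matrix.transpose_sub, Matrix.transpose_smul, hPt,
      Matrix.transpose_vecMulVec, Matrix.mul_add, Matrix.mul_sub, Matrix.add_mul,
      Matrix.sub_mul, Matrix.mul_smul, Matrix.smul_mul, h1, hEP, hEE]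
  have hY : Matrix.vecMulVec (E *ᵥ a) d * (γ • K + β • P) =
      c • Matrix.vecMulVec (E *ᵥ a) a + γ • Matrix.vecMulVec (E *ᵥ a) b := by
    rw [Matrix.vecMulVec_mul, hd, Matrix.vecMulVec_add, Matrix.vecMulVec_smul,
      Matrix.vecMulVec_smul]
  have hX : (γ • (E * Kᵀ * E) + β • P) * Matrix.vecMulVec (E *ᵥ d) a =
      c • Matrix.vecMulVec (E *ᵥ a) a + γ • Matrix.vecMulVec (E *ᵥ b) a := by
    have h1 : (γ • (E * Kᵀ * E) + β • P) *ᵥ (E *ᵥ d) = E *ᵥ (c • a + γ • b) := by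
      rw [← hd, ← Matrix.mulVec_transpose, Matrix.transpose_add, Matrix.transpose_smul,
        Matrix.transpose_smul, hPt, Matrix.add_mulVec, Matrix.add_mulVec, Matrix.mulVec_add,
        Matrix.smul_mulVec, Matrix.smul_mulVec, Matrix.smul_mulVec, Matrix.smul_mulVec,
        Matrix.mulVec_mulVec, Matrix.mulVec_mulVec, hPE, hPd, Matrix.mul_assoc, hEE,
        ← Matrix.mulVec_mulVec, hPd, Matrix.mulVec_smul, Matrix.mulVec_smul,
        Matrix.mulVec_mulVec]
    rw [Matrix.mul_vecMulVec, h1, Matrix.mulVec_add, Matrix.mulVec_smul, Matrix.mulVec_smul,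
      Matrix.add_vecMulVec, Matrix.smul_vecMulVec, Matrix.smul_vecMulVec]
  have hYX : Matrix.vecMulVec (E *ᵥ a) d * Matrix.vecMulVec (E *ᵥ d) a =
      (d ⬝ᵥ E *ᵥ d) • Matrix.vecMulVec (E *ᵥ a) a := by
    rw [Matrix.vecMulVec_mul_vecMulVec, Matrix.vecMulVec_smul]
  have hKP : E * Kᵀ * E * P = E * Kᵀ * E := by rw [Matrix.mul_assoc, hEP]
  have hc' := congrArg (fun t => (ρ * t) • Matrix.vecMulVec (E *ᵥ a) a) hc
  rw [hadj]
  generalize E * Kᵀ * E = L at *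
  generalize Matrix.vecMulVec (E *ᵥ a) d = Y at *
  generalize Matrix.vecMulVec (E *ᵥ d) a = X at *
  simp only [Matrix.mul_add, Matrix.mul_sub, Matrix.add_mul, Matrix.sub_mul, Matrix.mul_smul,
    Matrix.smul_mul, hPP, hPK, hKP, hYX] at hX hY hc' ⊢
  linear_combination (norm := module) γ • h - ρ • hX - ρ • hY + hc'

/-- Riccati transformation of the algebraic decomposability condition:
if α·Id + β(κ + κ̄) + γ(κ̄∘κ) = ρ(Ā⊗B) + ρ(B̄⊗A) and
D(γκ + β·Id) = (1/2)·tr(ρ D̄⊗D)·A + γ·B, then η = γκ − ρ(D̄⊗A) + β·Id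
satisfies η̄∘η = (β² − αγ)·Id. -/
theorem stmt10 (κ : MT) (hanti : antisymMT κ) (α β γ ρ : ℝ) (hγ : γ ≠ 0)
    (A B D : BV) (hA : antisymBV A) (hB : antisymBV B) (hD : antisymBV D)
    (heq : ∀ i j r s, α * idT i j r s + β * (κ i j r s + adjT κ i j r s) +
        γ * compT (adjT κ) κ i j r s = tensAB ρ A B i j r s + tensAB ρ B A i j r s)
    (hDcond : ∀ i j, bvAct D (fun i' j' r s => γ * κ i' j' r s + β * idT i' j' r s) i j =
        (1 / 2) * traceT (tensAB ρ D D) * A i j + γ * B i j) :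
    compT (adjT (fun i j r s => γ * κ i j r s - tensAB ρ D A i j r s + β * idT i j r s))
        (fun i j r s => γ * κ i j r s - tensAB ρ D A i j r s + β * idT i j r s) =
      fun i j r s => (β ^ 2 - α * γ) * idT i j r s := by
  apply pairMatrix_injective
  have hη : pairMatrix (fun i j r s => γ * κ i j r s - tensAB ρ D A i j r s + β * idT i j r s) =
      γ • pairMatrix κ - ρ • Matrix.vecMulVec (epsMatrix *ᵥ pairVec D) (pairVec A) +
        β • pairMatrix idT := by
    rw [← pairMatrix_tensAB]
    ext p q
    simp only [pairMatrix, Matrix.of_apply, Matrix.add_apply, Matrix.sub_apply,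
      Matrix.smul_apply, smul_eq_mul]
    ring
  have hgoal : pairMatrix (fun i j r s => (β ^ 2 - α * γ) * idT i j r s) =
      (β ^ 2 - α * γ) • pairMatrix idT := by
    ext p q
    simp only [pairMatrix, Matrix.of_apply, Matrix.smul_apply, smul_eq_mul]
    ring
  rw [pairMatrix_compT, pairMatrix_adjT, hη, hgoal]
  refine riccati_matrix (b := pairVec B) (c := (1 / 2) * traceT (tensAB ρ D D))
    epsMatrix_transpose epsMatrix_mul_self pairMatrix_idT_mul_epsMatrix
    (pairMatrix_idT_mul hanti) (pairMatrix_idT_mulVec hD) ?_ ?_ ?_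
  · rw [traceT_tensAB]
    ring
  · rw [← pairMatrix_adjT, ← pairMatrix_compT, ← pairMatrix_tensAB, ← pairMatrix_tensAB]
    ext p q
    have := heq q.1 q.2 p.1 p.2
    simp only [pairMatrix, Matrix.of_apply, Matrix.add_apply, Matrix.smul_apply, smul_eq_mul]
    linear_combination (1 / 2) * this
  · have hlin : pairMatrix (fun i j r s => γ * κ i j r s + β * idT i j r s) =
        γ • pairMatrix κ + β • pairMatrix idT := by
      ext p q
      simp only [pairMatrix, Matrix.of_apply, Matrix.add_apply, Matrix.smul_apply, smul_eq_mul]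
      ring
    rw [← hlin, ← pairVec_bvAct]
    ext p
    exact hDcond p.1 p.2
end
end
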